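/- arXiv:2308.05188 — 14 statements merged into one kernel-verified Lean document; each statement's English description precedes it below -/
import Mathlib

section
/- Let f ∈ ℂ[x] be a polynomial of degree d ≥ 2 with leading coefficient a₀ and roots α₁,…,α_d (with multiplicity). Then M(f)^(2d−2) ≥ d^(−d) · |Δ(f)|, where M(f) = |a₀| · ∏_{i=1}^{d} max{1,|α_i|} is the Mahler measure and Δ(f) = a₀^(2d−2) · ∏_{1≤i<j≤d} (α_i − α_j)² is the discriminant. -/
open Polynomial Finset

open scoped ComplexOrder in
/-- Hadamard's inequality for matrices with entries of norm at most one, via AM-GM. -/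
theorem hadamard_aux (d : ℕ) (hd : 2 ≤ d) (A : Matrix (Fin d) (Fin d) ℂ)
    (hA : ∀ i j, ‖A i j‖ ≤ 1) : ‖A.det‖ ^ 2 ≤ (d : ℝ) ^ d := by
  have hd0 : (0 : ℝ) < d := by positivity
  have hP := Matrix.posSemidef_self_mul_conjTranspose A
  have hdet : ‖A.det‖ ^ 2 = ∏ i, hP.isHermitian.eigenvalues i := by
    have h := hP.isHermitian.det_eq_prod_eigenvalues
    rw [Matrix.det_mul, Matrix.det_conjTranspose] at h
    have h2 : A.det * star A.det = ((‖A.det‖ ^ 2 : ℝ) : ℂ) := by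
      have := Complex.mul_conj' A.det
      simpa using this
    rw [h2] at h
    apply Complex.ofReal_injective
    rw [h]
    simp
  have htr : ∑ i, hP.isHermitian.eigenvalues i ≤ (d : ℝ) * d := by
    have h := hP.isHermitian.trace_eq_sum_eigenvalues
    have h2 : (A * A.conjTranspose).trace = ((∑ i, ∑ j, ‖A i j‖ ^ 2 : ℝ) : ℂ) := by
      simp only [Matrix.trace, Matrix.diag, Matrix.mul_apply, Matrix.conjTranspose_apply]
      push_cast
      refine Finset.sum_congr rfl fun i _ => Finset.sum_congr rfl fun j _ => ?_
      simpa using Complex.mul_conj' (A i j)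
    have h3 : ∑ i, hP.isHermitian.eigenvalues i = ∑ i, ∑ j, ‖A i j‖ ^ 2 := by
      apply Complex.ofReal_injective
      rw [← h2, h]
      simp
    rw [h3]
    calc ∑ i, ∑ j, ‖A i j‖ ^ 2 ≤ ∑ i : Fin d, ∑ j : Fin d, (1 : ℝ) := by
          refine Finset.sum_le_sum fun i _ => Finset.sum_le_sum fun j _ => ?_
          exact pow_le_one₀ (norm_nonneg _) (hA i j)
      _ = d * d := by simp
  have hnn := hP.eigenvalues_nonneg
  rw [hdet]
  generalize hP.isHermitian.eigenvalues = e at *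
  have h0 : 0 ≤ ∏ i, e i := Finset.prod_nonneg fun i _ => hnn i
  have amgm := Real.geom_mean_le_arith_mean Finset.univ (fun _ => (1 : ℝ)) e
    (fun _ _ => zero_le_one) (by simpa using (by omega : 0 < d)) (fun i _ => hnn i)
  simp only [Real.rpow_one, one_mul, Finset.sum_const, Finset.card_univ, Fintype.card_fin,
    nsmul_eq_mul, mul_one] at amgm
  have h1 : (∏ i, e i) ^ ((d : ℝ)⁻¹) ≤ d := amgm.trans ((div_le_iff₀ hd0).2 htr)
  calc ∏ i, e i = ((∏ i, e i) ^ ((d : ℝ)⁻¹)) ^ d :=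
        (Real.rpow_inv_natCast_pow h0 (by omega)).symm
    _ ≤ (d : ℝ) ^ d := pow_le_pow_left₀ (Real.rpow_nonneg h0 _) h1 _

/-- **Mahler's inequality (1964).** For a polynomial `f ∈ ℂ[x]` of degree `d ≥ 2` with
leading coefficient `a₀` and roots `α₁, …, α_d` (with multiplicity), the Mahler measure
`M(f) = |a₀| ∏ max{1,|αᵢ|}` and the discriminant
`Δ(f) = a₀^(2d-2) ∏_{i<j} (αᵢ - αⱼ)²` satisfy `M(f)^(2d-2) ≥ d^(-d) |Δ(f)|`. -/
theorem mahler_inequality (d : ℕ) (hd : 2 ≤ d) (f : Polynomial ℂ) (a₀ : ℂ) (ha₀ : a₀ ≠ 0)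
    (α : Fin d → ℂ) (hf : f = C a₀ * ∏ i, (X - C (α i))) :
    (‖a₀‖ * ∏ i, max 1 ‖α i‖) ^ (2 * d - 2) ≥
      ((d : ℝ) ^ d)⁻¹ *
        ‖a₀ ^ (2 * d - 2) *
          ∏ i, ∏ j ∈ univ.filter (fun j => i < j), (α i - α j) ^ 2‖ := by
  have hm : ∀ i, 0 < max 1 ‖α i‖ := fun i => lt_of_lt_of_le one_pos (le_max_left _ _)
  have hdet : (Matrix.vandermonde α).det = ∏ i, ∏ j ∈ univ.filter (fun j => i < j), (α j - α i) := by
    rw [Matrix.det_vandermonde]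
    refine Finset.prod_congr rfl fun i _ => Finset.prod_congr ?_ fun _ _ => rfl
    ext j; simp
  have hdisc : ‖∏ i, ∏ j ∈ univ.filter (fun j => i < j), (α i - α j) ^ 2‖
      = ‖(Matrix.vandermonde α).det‖ ^ 2 := by
    rw [hdet, ← norm_pow, ← Finset.prod_pow]
    congr 1
    refine Finset.prod_congr rfl fun i _ => ?_
    rw [← Finset.prod_pow]
    exact Finset.prod_congr rfl fun _ _ => by ring
  have hH := hadamard_aux d hd
    (Matrix.of fun i j => (((max 1 ‖α i‖ ^ (d - 1))⁻¹ : ℝ) : ℂ) * Matrix.vandermonde α i j) (by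
      intro i j
      simp only [Matrix.of_apply, Matrix.vandermonde_apply, norm_mul, norm_pow]
      rw [Complex.norm_of_nonneg (by have := hm i; positivity), inv_mul_le_iff₀ (pow_pos (hm i) _),
        mul_one]
      calc ‖α i‖ ^ (j : ℕ) ≤ max 1 ‖α i‖ ^ (j : ℕ) :=
            pow_le_pow_left₀ (norm_nonneg _) (le_max_right _ _) _
        _ ≤ _ := pow_le_pow_right₀ (le_max_left _ _) (by omega))
  rw [Matrix.det_mul_column, norm_mul, mul_pow, norm_prod] at hH
  have hpr : ∏ i, ‖(((max 1 ‖α i‖ ^ (d - 1))⁻¹ : ℝ) : ℂ)‖ = ((∏ i, max 1 ‖α i‖) ^ (d - 1))⁻¹ := by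
    rw [← Finset.prod_pow, ← Finset.prod_inv_distrib]
    refine Finset.prod_congr rfl fun i _ => ?_
    rw [Complex.norm_of_nonneg (by have := hm i; positivity)]
  have hM : 0 < ∏ i, max 1 ‖α i‖ := Finset.prod_pos fun i _ => hm i
  rw [hpr, inv_pow, ← pow_mul, inv_mul_le_iff₀ (by positivity),
    show (d - 1) * 2 = 2 * d - 2 by omega] at hH
  have hdd : (0 : ℝ) < (d : ℝ) ^ d := by positivity
  rw [norm_mul, hdisc, ge_iff_le, inv_mul_le_iff₀ hdd, norm_pow, mul_pow]
  nlinarith [mul_le_mul_of_nonneg_left hH (pow_nonneg (norm_nonneg a₀) (2 * d - 2))]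
end

section
/- Let f ∈ ℂ[x] be a polynomial of degree d ≥ 2. Equality M(f)^(2d−2) = d^(−d) · |Δ(f)| holds if and only if f = a₀·x^d + a_d for complex numbers a₀, a_d with |a₀| = |a_d| > 0. -/
open Polynomial Finset

lemma mahler_aux_amgm (d : ℕ) (l : Fin d → ℝ) (h0 : ∀ i, 0 ≤ l i)
    (hs : ∑ i, l i ≤ (d : ℝ) * d) (hp : ∏ i, l i = (d : ℝ) ^ d) : ∀ i, l i = d := by
  intro i
  have hdpos : (0 : ℝ) < d := by
    have := i.pos
    exact_mod_cast this
  have hpos : ∀ j, 0 < l j / d := by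
    intro j
    have hne : l j ≠ 0 := by
      intro h
      have : ∏ i, l i = 0 := Finset.prod_eq_zero (mem_univ j) h
      rw [hp] at this
      exact absurd this (by positivity)
    have := lt_of_le_of_ne (h0 j) (Ne.symm hne)
    positivity
  have hprod : ∏ j, (l j / d) = 1 := by
    rw [Finset.prod_div_distrib, hp]
    simp [hdpos.ne']
  have hlog : ∑ j, Real.log (l j / d) = 0 := by
    rw [← Real.log_prod (fun j _ => (hpos j).ne'), hprod, Real.log_one]
  have hsum : ∑ j, (l j / d - 1 - Real.log (l j / d)) ≤ 0 := by
    rw [Finset.sum_sub_distrib, Finset.sum_sub_distrib, hlog, ← Finset.sum_div]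
    simp only [Finset.sum_const, card_univ, Fintype.card_fin, nsmul_eq_mul, mul_one, sub_zero]
    have : (∑ j, l j) / d ≤ d := by
      rw [div_le_iff₀ hdpos]
      exact hs
    linarith
  have hnn : ∀ j ∈ (univ : Finset (Fin d)), 0 ≤ l j / d - 1 - Real.log (l j / d) := by
    intro j _
    have := Real.log_le_sub_one_of_pos (hpos j)
    linarith
  have hz := (Finset.sum_eq_zero_iff_of_nonneg hnn).1
    (le_antisymm hsum (Finset.sum_nonneg hnn)) i (mem_univ i)
  by_contra hne
  have hne' : l i / d ≠ 1 := by
    intro h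
    rw [div_eq_one_iff_eq hdpos.ne'] at h
    exact hne h
  have := Real.log_lt_sub_one_of_pos (hpos i) hne'
  linarith

lemma mahler_aux_diag (d : ℕ) (W : Matrix (Fin d) (Fin d) ℂ) (i : Fin d) :
    (W * W.conjTranspose) i i = ((∑ k, ‖W i k‖ ^ 2 : ℝ) : ℂ) := by
  rw [Matrix.mul_apply]
  push_cast
  refine Finset.sum_congr rfl fun k _ => ?_
  rw [Matrix.conjTranspose_apply]
  exact RCLike.mul_conj _

lemma mahler_aux_det (d : ℕ) (W : Matrix (Fin d) (Fin d) ℂ) :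
    (W * W.conjTranspose).det = ((‖W.det‖ ^ 2 : ℝ) : ℂ) := by
  rw [Matrix.det_mul, Matrix.det_conjTranspose]
  push_cast
  exact RCLike.mul_conj _

open scoped ComplexOrder in
lemma mahler_aux_gram (d : ℕ) (W : Matrix (Fin d) (Fin d) ℂ) (hW : ∀ i k, ‖W i k‖ ≤ 1)
    (hdet : ‖W.det‖ ^ 2 = (d : ℝ) ^ d) :
    W * W.conjTranspose = (d : ℂ) • (1 : Matrix (Fin d) (Fin d) ℂ) := by
  have hps : (W * W.conjTranspose).PosSemidef := Matrix.posSemidef_self_mul_conjTranspose W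
  have hh := hps.isHermitian
  have hev : ∀ i, hh.eigenvalues i = d := by
    apply mahler_aux_amgm
    · exact fun i => hps.eigenvalues_nonneg i
    · have h1 := hh.trace_eq_sum_eigenvalues
      have h2 : (W * W.conjTranspose).trace = ((∑ i, ∑ k, ‖W i k‖ ^ 2 : ℝ) : ℂ) := by
        rw [Matrix.trace]
        simp only [Matrix.diag_apply, mahler_aux_diag]
        push_cast
        rfl
      rw [h2] at h1
      have h3 : ∑ i, ∑ k, ‖W i k‖ ^ 2 = ∑ i, hh.eigenvalues i := by
        have : ((∑ i, ∑ k, ‖W i k‖ ^ 2 : ℝ) : ℂ) = ((∑ i, hh.eigenvalues i : ℝ) : ℂ) := by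
          rw [h1]
          push_cast
          rfl
        exact_mod_cast this
      rw [← h3]
      calc ∑ i, ∑ k, ‖W i k‖ ^ 2 ≤ ∑ i : Fin d, ∑ k : Fin d, (1 : ℝ) := by
            gcongr with i _ k _
            exact pow_le_one₀ (norm_nonneg _) (hW i k)
        _ = (d : ℝ) * d := by simp
    · have h1 := hh.det_eq_prod_eigenvalues
      rw [mahler_aux_det, hdet] at h1
      have : (((d : ℝ) ^ d : ℝ) : ℂ) = ((∏ i, hh.eigenvalues i : ℝ) : ℂ) := by
        rw [h1]
        push_cast
        rfl
      exact_mod_cast this.symm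
  have hspec := hh.spectral_theorem
  have hD : Matrix.diagonal ((RCLike.ofReal : ℝ → ℂ) ∘ hh.eigenvalues)
      = (d : ℂ) • (1 : Matrix (Fin d) (Fin d) ℂ) := by
    rw [Matrix.smul_one_eq_diagonal]
    congr 1
    ext i
    simp [hev]
  rw [hD, map_smul, map_one] at hspec
  exact hspec

/-- The row-normalised Vandermonde matrix. -/
noncomputable def mahlerW (d : ℕ) (α : Fin d → ℂ) : Matrix (Fin d) (Fin d) ℂ :=
  Matrix.of fun i k => (((max 1 ‖α i‖ ^ (d - 1))⁻¹ : ℝ) : ℂ) * Matrix.vandermonde α i k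

lemma mahler_aux_detW (d : ℕ) (α : Fin d → ℂ) :
    ‖(mahlerW d α).det‖ ^ 2 = ((∏ i, max 1 ‖α i‖) ^ (2 * d - 2))⁻¹ *
      ‖∏ i, ∏ j ∈ univ.filter (fun j => i < j), (α i - α j) ^ 2‖ := by
  unfold mahlerW
  rw [Matrix.det_mul_column, Matrix.det_vandermonde, norm_mul, mul_pow]
  congr 1
  · rw [norm_prod, ← Finset.prod_pow, ← Finset.prod_pow, ← Finset.prod_inv_distrib]
    refine Finset.prod_congr rfl fun i _ => ?_
    have h : (0 : ℝ) ≤ (max 1 ‖α i‖ ^ (d - 1))⁻¹ := by positivity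
    rw [Complex.norm_real, Real.norm_of_nonneg h, inv_pow, ← pow_mul]
    congr 2
    omega
  · rw [← norm_pow, ← Finset.prod_pow]
    congr 1
    refine Finset.prod_congr rfl fun i _ => ?_
    rw [← Finset.prod_pow]
    refine Finset.prod_congr (by ext j; simp) fun j _ => ?_
    ring

lemma mahler_aux_iff (d : ℕ) (hd : 2 ≤ d) (a₀ : ℂ) (ha₀ : a₀ ≠ 0) (α : Fin d → ℂ) :
    ((‖a₀‖ * ∏ i, max 1 ‖α i‖) ^ (2 * d - 2) =
      ((d : ℝ) ^ d)⁻¹ *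
        ‖a₀ ^ (2 * d - 2) *
          ∏ i, ∏ j ∈ univ.filter (fun j => i < j), (α i - α j) ^ 2‖) ↔
    ‖(mahlerW d α).det‖ ^ 2 = (d : ℝ) ^ d := by
  rw [mahler_aux_detW, norm_mul, norm_pow, mul_pow]
  have h1 : 0 < ‖a₀‖ ^ (2 * d - 2) := by positivity
  have h2 : 0 < (∏ i, max 1 ‖α i‖) ^ (2 * d - 2) := by
    apply pow_pos
    exact Finset.prod_pos fun i _ => by positivity
  have h3 : (0 : ℝ) < (d : ℝ) ^ d := by positivity
  generalize ‖a₀‖ ^ (2 * d - 2) = a at *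
  generalize (∏ i, max 1 ‖α i‖) ^ (2 * d - 2) = m at *
  generalize (d : ℝ) ^ d = D at *
  generalize ‖∏ i, ∏ j ∈ univ.filter (fun j => i < j), (α i - α j) ^ 2‖ = E at *
  constructor
  · intro h
    field_simp at h ⊢
    linarith
  · intro h
    field_simp at h ⊢
    linarith

lemma mahler_aux_W_le (d : ℕ) (α : Fin d → ℂ) (i k : Fin d) : ‖mahlerW d α i k‖ ≤ 1 := by
  have h : (0 : ℝ) ≤ (max 1 ‖α i‖ ^ (d - 1))⁻¹ := by positivity
  have hp : (0 : ℝ) < max 1 ‖α i‖ ^ (d - 1) := by positivity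
  simp only [mahlerW, Matrix.of_apply, Matrix.vandermonde_apply]
  rw [norm_mul, Complex.norm_real, Real.norm_of_nonneg h, norm_pow, inv_mul_le_iff₀ hp, mul_one]
  calc ‖α i‖ ^ (k : ℕ) ≤ max 1 ‖α i‖ ^ (k : ℕ) := by gcongr; exact le_max_right _ _
    _ ≤ max 1 ‖α i‖ ^ (d - 1) := by
      apply pow_le_pow_right₀ (le_max_left _ _)
      have := k.isLt
      omega

lemma mahler_aux_W_eq (d : ℕ) (α : Fin d → ℂ) (h : ∀ i, ‖α i‖ = 1) (i k : Fin d) :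
    mahlerW d α i k = α i ^ (k : ℕ) := by
  simp [mahlerW, Matrix.vandermonde_apply, h]

/-- Off-diagonal entries as geometric sums. -/
lemma mahler_aux_gram_entry (d : ℕ) (α : Fin d → ℂ) (h : ∀ i, ‖α i‖ = 1) (i j : Fin d) :
    (mahlerW d α * (mahlerW d α).conjTranspose) i j
      = ∑ k ∈ range d, (α i * (starRingEnd ℂ) (α j)) ^ k := by
  rw [Matrix.mul_apply, ← Fin.sum_univ_eq_sum_range (fun k => (α i * (starRingEnd ℂ) (α j)) ^ k)]
  refine Finset.sum_congr rfl fun k _ => ?_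
  rw [Matrix.conjTranspose_apply, mahler_aux_W_eq d α h, mahler_aux_W_eq d α h, mul_pow]
  simp

lemma mahler_aux_conj (z : ℂ) (h : ‖z‖ = 1) : (starRingEnd ℂ) z * z = 1 := by
  rw [RCLike.conj_mul, h]
  simp

theorem mahler_inequality_equality_iff (d : ℕ) (hd : 2 ≤ d) (f : Polynomial ℂ) (a₀ : ℂ)
    (ha₀ : a₀ ≠ 0) (α : Fin d → ℂ) (hf : f = C a₀ * ∏ i, (X - C (α i))) :
    (‖a₀‖ * ∏ i, max 1 ‖α i‖) ^ (2 * d - 2) =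
      ((d : ℝ) ^ d)⁻¹ *
        ‖a₀ ^ (2 * d - 2) *
          ∏ i, ∏ j ∈ univ.filter (fun j => i < j), (α i - α j) ^ 2‖ ↔
    ∃ b₀ bd : ℂ, f = C b₀ * X ^ d + C bd ∧ ‖b₀‖ = ‖bd‖ ∧ 0 < ‖b₀‖ := by
  rw [mahler_aux_iff d hd a₀ ha₀ α]
  constructor
  · intro hdet
    have hG := mahler_aux_gram d _ (mahler_aux_W_le d α) hdet
    have hone : ∀ i k, ‖mahlerW d α i k‖ = 1 := by
      intro i k
      have h1 := mahler_aux_diag d (mahlerW d α) i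
      rw [hG] at h1
      simp only [Matrix.smul_apply, Matrix.one_apply_eq, smul_eq_mul, mul_one] at h1
      have h2 : (d : ℝ) = ∑ k, ‖mahlerW d α i k‖ ^ 2 := by exact_mod_cast h1
      have hle : ∀ k ∈ (univ : Finset (Fin d)), ‖mahlerW d α i k‖ ^ 2 ≤ 1 :=
        fun k _ => pow_le_one₀ (norm_nonneg _) (mahler_aux_W_le d α i k)
      have h3 := (Finset.sum_eq_sum_iff_of_le hle).1 (by rw [← h2]; simp) k (mem_univ k)
      exact (pow_eq_one_iff_of_nonneg (norm_nonneg _) two_ne_zero).1 h3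
    have hα : ∀ i, ‖α i‖ = 1 := by
      intro i
      have h0 := hone i ⟨0, by omega⟩
      have h1 := hone i ⟨d - 1, by omega⟩
      have h : (0 : ℝ) ≤ (max 1 ‖α i‖ ^ (d - 1))⁻¹ := by positivity
      simp only [mahlerW, Matrix.of_apply, Matrix.vandermonde_apply] at h0 h1
      rw [norm_mul, Complex.norm_real, Real.norm_of_nonneg h] at h0 h1
      rw [pow_zero, norm_one, mul_one] at h0
      rw [h0, one_mul, norm_pow] at h1
      exact (pow_eq_one_iff_of_nonneg (norm_nonneg _) (by omega)).1 h1
    have hpow : ∀ i j, α i ^ d = α j ^ d := by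
      intro i j
      by_cases hij : i = j
      · rw [hij]
      have h1 := mahler_aux_gram_entry d α hα i j
      rw [hG] at h1
      simp only [Matrix.smul_apply, Matrix.one_apply_ne hij, smul_zero] at h1
      have h2 := mul_geom_sum (α i * (starRingEnd ℂ) (α j)) d
      rw [← h1, mul_zero] at h2
      have h3 : (α i * (starRingEnd ℂ) (α j)) ^ d = 1 := (sub_eq_zero.1 h2.symm)
      calc α i ^ d = α i ^ d * ((starRingEnd ℂ) (α j) * α j) ^ d := by
            rw [mahler_aux_conj _ (hα j)]; simp
        _ = (α i * (starRingEnd ℂ) (α j)) ^ d * α j ^ d := by ring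
        _ = α j ^ d := by rw [h3, one_mul]
    have hinj : Function.Injective α := by
      intro i j hij
      by_contra hne
      have : (mahlerW d α).det = 0 := by
        apply Matrix.det_zero_of_row_eq hne
        ext k
        rw [mahler_aux_W_eq d α hα, mahler_aux_W_eq d α hα, hij]
      rw [this] at hdet
      have h3 : (0 : ℝ) < (d : ℝ) ^ d := by positivity
      rw [← hdet] at h3
      simp at h3
    set c := α ⟨0, by omega⟩ ^ d with hc
    have hprod : ∏ i, (X - C (α i)) = X ^ d - C c := by
      have hm1 : (∏ i, (X - C (α i))).Monic := monic_prod_X_sub_C _ _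
      have hd1 : (∏ i, (X - C (α i))).degree = (d : WithBot ℕ) := by
        rw [degree_prod]; simp
      have hd2 : (X ^ d - C c).degree = (d : WithBot ℕ) :=
        degree_X_pow_sub_C (by omega) c
      have hm2 : (X ^ d - C c).Monic := monic_X_pow_sub_C c (by omega)
      refine Polynomial.eq_of_degree_sub_lt_of_eval_index_eq univ hinj.injOn ?_ ?_
      · have := degree_sub_lt (hd1.trans hd2.symm) hm1.ne_zero
          (by rw [hm1.leadingCoeff, hm2.leadingCoeff])
        rw [hd1] at this
        simpa using this
      · intro i _
        rw [eval_prod, Finset.prod_eq_zero (mem_univ i) (by simp)]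
        simp [hc, hpow i ⟨0, by omega⟩]
    refine ⟨a₀, -(a₀ * c), ?_, ?_, norm_pos_iff.2 ha₀⟩
    · rw [hf, hprod, C_neg, C_mul]; ring
    · rw [norm_neg, norm_mul, hc, norm_pow, hα]; simp
  · rintro ⟨b₀, bd, hfb, hn, hpos⟩
    have hb0 : b₀ ≠ 0 := norm_pos_iff.1 hpos
    have hroot : ∀ i, b₀ * α i ^ d + bd = 0 := by
      intro i
      have h1 : f.eval (α i) = 0 := by
        rw [hf, eval_mul, eval_prod, Finset.prod_eq_zero (mem_univ i) (by simp), mul_zero]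
      rw [hfb] at h1
      simpa using h1
    have hα : ∀ i, ‖α i‖ = 1 := by
      intro i
      have h1 : ‖b₀ * α i ^ d‖ = ‖bd‖ := by
        rw [eq_neg_of_add_eq_zero_left (hroot i), norm_neg]
      rw [norm_mul, norm_pow, ← hn] at h1
      have h2 : ‖α i‖ ^ d = 1 := by
        exact mul_left_cancel₀ hpos.ne' (by rw [h1, mul_one])
      exact (pow_eq_one_iff_of_nonneg (norm_nonneg _) (by omega)).1 h2
    have hinj : ∀ i j, i ≠ j → α i ≠ α j := by
      intro i j hij heq
      have h1 : f = (X - C (α i)) * ((X - C (α i)) *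
          (C a₀ * ∏ k ∈ (univ.erase i).erase j, (X - C (α k)))) := by
        rw [hf, ← Finset.mul_prod_erase univ _ (mem_univ i),
          ← Finset.mul_prod_erase (univ.erase i) _ (mem_erase.2 ⟨hij.symm, mem_univ j⟩), ← heq]
        ring
      have h2 : f.derivative.eval (α i) = 0 := by
        rw [h1, derivative_mul]
        simp
      rw [hfb] at h2
      have h3 : α i ≠ 0 := by
        intro h
        have := hα i
        rw [h] at this
        simp at this
      have h4 : b₀ * ((d : ℂ) * α i ^ (d - 1)) = 0 := by
        simpa [derivative_X_pow] using h2
      have h5 : (d : ℂ) ≠ 0 := by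
        have : d ≠ 0 := by omega
        exact_mod_cast this
      exact mul_ne_zero hb0 (mul_ne_zero h5 (pow_ne_zero _ h3)) h4
    have hG : mahlerW d α * (mahlerW d α).conjTranspose
        = (d : ℂ) • (1 : Matrix (Fin d) (Fin d) ℂ) := by
      ext i j
      rw [mahler_aux_gram_entry d α hα]
      by_cases hij : i = j
      · subst hij
        rw [mul_comm, mahler_aux_conj _ (hα i)]
        simp
      · rw [Matrix.smul_apply, Matrix.one_apply_ne hij, smul_zero]
        have h2 := mul_geom_sum (α i * (starRingEnd ℂ) (α j)) d
        have hpe : α i ^ d = α j ^ d := by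
          apply mul_left_cancel₀ hb0
          linear_combination hroot i - hroot j
        rw [mul_pow, hpe, ← mul_pow, mul_comm (α j), mahler_aux_conj _ (hα j), one_pow,
          sub_self] at h2
        refine (mul_eq_zero.1 h2).resolve_left fun h => hinj i j hij ?_
        linear_combination α j * h - α i * mahler_aux_conj _ (hα j)
    have h1 := mahler_aux_det d (mahlerW d α)
    rw [hG, Matrix.det_smul, Matrix.det_one, mul_one, Fintype.card_fin] at h1
    exact_mod_cast h1.symm
end

section
/- Let p be a prime number, d ≥ 2 an integer, and f = (p+1)·x^d − p ∈ ℤ[x]. Then |Δ(f)| = d^d · (p(p+1))^(d−1), M(f) = p+1, and consequently M(f)^(2d−2) = d^(−d) · |Δ(f)| · ((p+1)/p)^(d−1). -/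
open Polynomial Finset

/-- For a prime `p`, `d ≥ 2`, and `f = (p+1)x^d - p`, one has
`|Δ(f)| = d^d (p(p+1))^(d-1)`, `M(f) = p+1`, and consequently
`M(f)^(2d-2) = d^(-d) |Δ(f)| ((p+1)/p)^(d-1)`. -/
theorem mahler_example_sharpness (p : ℕ) (hp : p.Prime) (d : ℕ) (hd : 2 ≤ d)
    (f : Polynomial ℂ) (hfdef : f = C ((p : ℂ) + 1) * X ^ d - C (p : ℂ))
    (α : Fin d → ℂ) (hf : f = C ((p : ℂ) + 1) * ∏ i, (X - C (α i))) :
    ‖((p : ℂ) + 1) ^ (2 * d - 2) *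
        ∏ i, ∏ j ∈ univ.filter (fun j => i < j), (α i - α j) ^ 2‖ =
      (d : ℝ) ^ d * ((p : ℝ) * ((p : ℝ) + 1)) ^ (d - 1) ∧
    ((p : ℝ) + 1) * ∏ i, max 1 ‖α i‖ = (p : ℝ) + 1 ∧
    (((p : ℝ) + 1) * ∏ i, max 1 ‖α i‖) ^ (2 * d - 2) =
      ((d : ℝ) ^ d)⁻¹ *
        ‖((p : ℂ) + 1) ^ (2 * d - 2) *
          ∏ i, ∏ j ∈ univ.filter (fun j => i < j), (α i - α j) ^ 2‖ *
        (((p : ℝ) + 1) / (p : ℝ)) ^ (d - 1) := by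
  have hpp : (0:ℝ) < p := by exact_mod_cast hp.pos
  have ha : ((p:ℂ) + 1) ≠ 0 := by exact_mod_cast Nat.succ_ne_zero p
  have hna : ‖((p:ℂ) + 1)‖ = (p:ℝ) + 1 := by
    have : ((p:ℂ) + 1) = ((p + 1 : ℕ) : ℂ) := by push_cast; ring
    rw [this, Complex.norm_natCast]; push_cast; ring
  have hap : (0:ℝ) < (p:ℝ) + 1 := by positivity
  have heq : C ((p : ℂ) + 1) * X ^ d - C (p : ℂ) = C ((p : ℂ) + 1) * ∏ i, (X - C (α i)) :=
    hfdef.symm.trans hf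
  -- each root has norm at most one
  have hroot : ∀ i, ‖α i‖ ≤ 1 := by
    intro i
    have h := congrArg (eval (α i)) heq
    have hz : ∏ j, (α i - α j) = 0 := Finset.prod_eq_zero (Finset.mem_univ i) (sub_self _)
    simp only [eval_sub, eval_mul, eval_C, eval_pow, eval_X, eval_prod, hz, mul_zero] at h
    have h2 := congrArg norm (sub_eq_zero.mp h)
    rw [norm_mul, norm_pow, hna, Complex.norm_natCast] at h2
    by_contra hlt
    push Not at hlt
    have h3 : 1 ≤ ‖α i‖ ^ d := one_le_pow₀ hlt.le
    nlinarith
  have hM : ∏ i, max 1 ‖α i‖ = 1 :=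
    Finset.prod_eq_one fun i _ => max_eq_left (hroot i)
  -- product of the norms of the roots
  have hprod : ∏ i, ‖α i‖ = (p:ℝ) / (p + 1) := by
    have h := congrArg (eval 0) heq
    simp only [eval_sub, eval_mul, eval_C, eval_pow, eval_X, eval_prod,
      zero_pow (by omega : d ≠ 0), mul_zero, zero_sub] at h
    have h2 := congrArg norm h
    rw [norm_neg, norm_mul, norm_prod, hna, Complex.norm_natCast] at h2
    simp only [norm_neg] at h2
    rw [eq_div_iff hap.ne', mul_comm]; exact h2.symm
  -- derivative at the roots
  have hder : ∀ i, ∏ j ∈ ({i} : Finset (Fin d))ᶜ, ‖α j - α i‖ = d * ‖α i‖ ^ (d - 1) := by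
    intro i
    have hsplit : ∏ j, (X - C (α j)) = (X - C (α i)) * ∏ j ∈ ({i} : Finset (Fin d))ᶜ, (X - C (α j)) :=
      Fintype.prod_eq_mul_prod_compl i _
    have h := congrArg (fun q => eval (α i) (derivative q)) heq
    rw [hsplit] at h
    simp [derivative_mul, eval_prod, ha, derivative_X_pow] at h
    have h2 := congrArg norm h
    rw [norm_mul, norm_pow, norm_prod, Complex.norm_natCast] at h2
    rw [h2]
    exact Finset.prod_congr rfl fun j _ => norm_sub_rev _ _
  have hdisc : ‖((p : ℂ) + 1) ^ (2 * d - 2) *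
        ∏ i, ∏ j ∈ univ.filter (fun j => i < j), (α i - α j) ^ 2‖ =
      (d : ℝ) ^ d * ((p : ℝ) * ((p : ℝ) + 1)) ^ (d - 1) := by
    have hoff := Finset.prod_prod_Ioi_mul_eq_prod_prod_off_diag (fun i j : Fin d => ‖α i - α j‖)
    simp only [hder, Finset.prod_mul_distrib, Finset.prod_pow, hprod] at hoff
    have hI : ∀ i : Fin d, univ.filter (fun j => i < j) = Finset.Ioi i := by
      intro i; ext j; simp
    rw [norm_mul, norm_pow, hna, norm_prod]
    have hs : ∏ i, ‖∏ j ∈ univ.filter (fun j => i < j), (α i - α j) ^ 2‖ =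
        (d:ℝ) ^ d * ((p:ℝ) / (p + 1)) ^ (d - 1) := by
      have hc : ∏ _i : Fin d, (d:ℝ) = (d:ℝ) ^ d := by simp
      rw [← hc, ← hoff, ← Finset.prod_mul_distrib]
      refine Finset.prod_congr rfl fun i _ => ?_
      rw [hI, norm_prod, ← Finset.prod_mul_distrib]
      refine Finset.prod_congr rfl fun j _ => ?_
      rw [norm_pow, norm_sub_rev (α j), sq]
    rw [hs, show 2 * d - 2 = 2 * (d - 1) by omega, pow_mul, mul_left_comm, ← mul_pow]
    congr 2
    field_simp
  refine ⟨hdisc, by rw [hM, mul_one], ?_⟩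
  rw [hdisc, hM, mul_one, show 2 * d - 2 = 2 * (d - 1) by omega, pow_mul]
  have hd0 : (d:ℝ) ^ d ≠ 0 := pow_ne_zero _ (by positivity)
  rw [inv_mul_cancel_left₀ hd0, ← mul_pow]
  congr 1
  field_simp
end

section
/- Let p be a prime number, d ≥ 2 an integer, and f = x^d + p·x^(d−1) + (−1)^(d+1)·p ∈ ℤ[x]. Then |Δ(f)| = p^(d−1) · (d^d + ((d−1)p)^(d−1)), and in particular |Δ(f)| > (d−1)^(d−1) · p^(2d−2). -/
open Polynomial Finset

lemma aux_eval_deriv {n : ℕ} (α : Fin n → ℂ) (i : Fin n) :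
    (derivative (∏ j, (X - C (α j)))).eval (α i) = ∏ j ∈ univ.erase i, (α i - α j) := by
  rw [← Finset.mul_prod_erase univ _ (mem_univ i), derivative_mul]
  simp [eval_prod]

lemma aux_prod {n : ℕ} (g : Fin n → Fin n → ℝ) (hg : ∀ i j, g i j = g j i) :
    ∏ i, ∏ j ∈ univ.filter (fun j => i < j), (g i j) ^ 2 = ∏ i, ∏ j ∈ univ.erase i, g i j := by
  have h1 : ∀ i : Fin n, ∏ j ∈ univ.erase i, g i j =
      (∏ j ∈ univ.filter (fun j => i < j), g i j) * ∏ j ∈ univ.filter (fun j => j < i), g i j := by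
    intro i
    rw [← Finset.prod_union]
    · apply Finset.prod_congr _ (fun _ _ => rfl)
      ext j
      simp only [mem_erase, mem_univ, and_true, mem_union, mem_filter, true_and]
      rw [ne_comm, ne_iff_lt_or_gt]
    · rw [Finset.disjoint_left]
      intro j
      simp only [mem_filter, mem_univ, true_and]
      exact fun h h' => lt_asymm h h'
  simp_rw [h1]
  rw [Finset.prod_mul_distrib]
  have h2 : ∏ i, ∏ j ∈ univ.filter (fun j => j < i), g i j
      = ∏ i, ∏ j ∈ univ.filter (fun j => i < j), g i j := by
    rw [Finset.prod_comm' (t' := univ) (s' := fun j => univ.filter (fun i => j < i))]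
    · exact Finset.prod_congr rfl fun i _ => Finset.prod_congr rfl fun j _ => hg _ _
    · simp
  rw [h2]
  simp_rw [Finset.prod_pow]
  ring

/-- For a prime `p`, `d ≥ 2`, and the Eisenstein polynomial
`f = x^d + p x^(d-1) + (-1)^(d+1) p`, one has
`|Δ(f)| = p^(d-1) (d^d + ((d-1)p)^(d-1))`, and in particular
`|Δ(f)| > (d-1)^(d-1) p^(2d-2)`. -/
theorem eisenstein_discriminant (p : ℕ) (hp : p.Prime) (d : ℕ) (hd : 2 ≤ d)
    (f : Polynomial ℂ)
    (hfdef : f = X ^ d + C (p : ℂ) * X ^ (d - 1) + C ((-1 : ℂ) ^ (d + 1) * (p : ℂ)))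
    (α : Fin d → ℂ) (hf : f = ∏ i, (X - C (α i))) :
    ‖∏ i, ∏ j ∈ univ.filter (fun j => i < j), (α i - α j) ^ 2‖ =
      (p : ℝ) ^ (d - 1) * ((d : ℝ) ^ d + (((d : ℝ) - 1) * (p : ℝ)) ^ (d - 1)) ∧
    ‖∏ i, ∏ j ∈ univ.filter (fun j => i < j), (α i - α j) ^ 2‖ >
      ((d : ℝ) - 1) ^ (d - 1) * (p : ℝ) ^ (2 * d - 2) := by
  have hp0 : (0 : ℝ) < p := by exact_mod_cast hp.pos
  have main : ‖∏ i, ∏ j ∈ univ.filter (fun j => i < j), (α i - α j) ^ 2‖ =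
      (p : ℝ) ^ (d - 1) * ((d : ℝ) ^ d + (((d : ℝ) - 1) * (p : ℝ)) ^ (d - 1)) := by
    obtain ⟨n, rfl⟩ : ∃ n, d = n + 2 := ⟨d - 2, by omega⟩
    have hev : ∀ z : ℂ, ∏ i, (z - α i) =
        z ^ (n + 2) + p * z ^ (n + 1) + (-1) ^ (n + 3) * p := by
      intro z
      have := congrArg (eval z) (hf.symm.trans hfdef)
      simpa [eval_prod] using this
    have hder : ∀ i, ∏ j ∈ univ.erase i, (α i - α j) =
        (α i) ^ n * ((n + 2) * α i + (n + 1) * p) := by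
      intro i
      rw [← aux_eval_deriv, ← hf, hfdef, derivative_add, derivative_C]
      simp
      ring
    have hn2 : (n + 2 : ℂ) ≠ 0 := by exact_mod_cast (by omega : n + 2 ≠ 0)
    have hα : ∏ i, ‖α i‖ = p := by
      have := congrArg norm (hev 0)
      simpa using this
    have hβ : ∏ i, ((n + 2) * α i + (n + 1) * p) =
        p * ((n + 2 : ℂ) ^ (n + 2) + ((n + 1) * p) ^ (n + 1)) * (-1) ^ (2 * n + 5) := by
      have h1 : ∀ i, ((n + 2) * α i + (n + 1) * p : ℂ) =
          (-(n + 2)) * (-((n + 1) * p) / (n + 2) - α i) := by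
        intro i; field_simp; ring
      simp_rw [h1]
      rw [Finset.prod_mul_distrib, hev]
      simp only [prod_const, card_univ, Fintype.card_fin]
      rw [neg_pow (n + 2 : ℂ), div_pow, div_pow, neg_pow ((n + 1) * p : ℂ) (n + 2),
        neg_pow ((n + 1) * p : ℂ) (n + 1)]
      have e : ((-1 : ℂ) ^ n) ^ 2 = 1 := by rw [← pow_mul, mul_comm, pow_mul]; simp
      have e2 : (-1 : ℂ) ^ (2 * n + 5) = -1 := Odd.neg_one_pow ⟨n + 2, by ring⟩
      rw [e2]
      simp only [pow_add (-1 : ℂ)]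
      rw [pow_succ (n + 2 : ℂ) (n + 1), pow_succ ((n + 1) * p : ℂ) (n + 1)]
      have hne : (n + 2 : ℂ) ^ (n + 1) ≠ 0 := pow_ne_zero _ hn2
      generalize (n + 2 : ℂ) ^ (n + 1) = A at *
      generalize ((n + 1) * p : ℂ) ^ (n + 1) = B at *
      field_simp
      generalize (-1 : ℂ) ^ n = s at *
      linear_combination (-(p * (A * (n + 2) + B))) * e
    rw [norm_prod]
    simp_rw [norm_prod, norm_pow]
    rw [aux_prod (fun i j => ‖α i - α j‖) (fun i j => norm_sub_rev _ _)]
    have h3 : ∀ i, ∏ j ∈ univ.erase i, ‖α i - α j‖ =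
        ‖α i‖ ^ n * ‖(n + 2) * α i + (n + 1) * p‖ := by
      intro i
      rw [← norm_prod, hder, norm_mul, norm_pow]
    simp_rw [h3]
    rw [Finset.prod_mul_distrib, Finset.prod_pow, hα, ← norm_prod, hβ]
    have : ((n + 2 : ℂ) ^ (n + 2) + ((n + 1) * p) ^ (n + 1)) =
      (((n + 2) ^ (n + 2) + ((n + 1) * p) ^ (n + 1) : ℕ) : ℂ) := by push_cast; rfl
    rw [this, norm_mul, norm_mul, Complex.norm_natCast, Complex.norm_natCast]
    simp only [norm_pow, norm_neg, norm_one, one_pow]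
    push_cast
    rw [show ((n : ℝ) + 2 - 1) = n + 1 by ring]
    ring
  refine ⟨main, ?_⟩
  rw [main, show 2 * d - 2 = (d - 1) + (d - 1) by omega, pow_add, mul_pow]
  have h : (0 : ℝ) < (p : ℝ) ^ (d - 1) * (d : ℝ) ^ d := by
    have : (0 : ℝ) < d := by exact_mod_cast (by omega : 0 < d)
    positivity
  nlinarith [h]
end

section
/- Let p be a prime number, d ≥ 2 an integer, and f = x^d + p·x^(d−1) + (−1)^(d+1)·p ∈ ℤ[x]. Then M(f) < 3p, and consequently M(f)^(2d−2) < (9/(d−1))^(d−1) · |Δ(f)|. -/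
open Polynomial Finset

lemma aux_mahler (p : ℕ) (hp : p.Prime) (n : ℕ) (f : Polynomial ℂ)
    (hfdef : f = X ^ (n+2) + C (p : ℂ) * X ^ (n + 1) + C ((-1 : ℂ) ^ (n + 3) * (p : ℂ)))
    (α : Fin (n+2) → ℂ) (hf : f = ∏ i, (X - C (α i))) :
    (∏ i, max 1 ‖α i‖) < 3 * (p : ℝ) := by
  have h1 : f.mahlerMeasure = ∏ i, max 1 ‖α i‖ := by
    rw [mahlerMeasure_eq_leadingCoeff_mul_prod_roots, hf]
    have hm : (∏ i, (X - C (α i))).Monic := monic_prod_of_monic _ _ fun i _ => monic_X_sub_C _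
    rw [hm.leadingCoeff, roots_prod _ _ hm.ne_zero]
    simp only [norm_one, one_mul, roots_X_sub_C, Multiset.bind_singleton, Multiset.map_map]
    rfl
  have h2 := mahlerMeasure_le_sum_norm_coeff f
  have hp2 : (2:ℝ) ≤ p := by exact_mod_cast hp.two_le
  have h3 : (f.sum fun _ a ↦ ‖a‖) ≤ 1 + p + p := by
    have hdeg : f.natDegree < n + 3 := by
      rw [hf, natDegree_prod_of_monic _ _ fun i _ => monic_X_sub_C _]; simp
    rw [sum_over_range' f (by simp) _ hdeg]
    calc ∑ i ∈ range (n+3), ‖f.coeff i‖ ≤ ∑ i ∈ range (n+3),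
          ((if i = n+2 then (1:ℝ) else 0) + (if i = n+1 then (p:ℝ) else 0)
            + (if i = 0 then (p:ℝ) else 0)) := by
          refine Finset.sum_le_sum fun i _ => ?_
          rw [hfdef]
          simp only [coeff_add, coeff_C_mul, coeff_X_pow, coeff_C]
          refine (norm_add₃_le).trans ?_
          gcongr <;> split_ifs <;> simp
      _ = 1 + p + p := by
          simp [Finset.sum_add_distrib]
  rw [← h1]; linarith

lemma aux_disc (n : ℕ) (α : Fin n → ℂ) :
    ‖∏ i, ∏ j ∈ univ.filter (fun j => i < j), (α i - α j) ^ 2‖ =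
      ‖∏ i, (derivative (∏ j, (X - C (α j)))).eval (α i)‖ := by
  have h : ∀ i, (derivative (∏ j, (X - C (α j)))).eval (α i)
      = ∏ j ∈ univ.erase i, (α i - α j) := by
    intro i
    rw [derivative_prod_finset, eval_finsetSum, Finset.sum_eq_single i]
    · simp [eval_prod]
    · intro b _ hb
      simp only [eval_mul, eval_prod]
      rw [Finset.prod_eq_zero (i := i)] <;> simp [hb.symm]
    · simp
  simp_rw [h]
  have key := Finset.prod_prod_Ioi_mul_eq_prod_prod_off_diag (α := Fin n) (fun i j => ‖α j - α i‖)
  simp only [norm_prod, norm_pow]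
  have e : ∀ i : Fin n, univ.filter (fun j => i < j) = Ioi i := by intro i; ext; simp
  have e2 : ∀ i : Fin n, univ.erase i = {i}ᶜ := by intro i; ext; simp
  simp_rw [e, e2, ← key]
  refine Finset.prod_congr rfl fun i _ => Finset.prod_congr rfl fun j _ => ?_
  rw [norm_sub_rev (α j), sq]

lemma aux_val (p : ℕ) (n : ℕ) (f : Polynomial ℂ)
    (hfdef : f = X ^ (n+2) + C (p : ℂ) * X ^ (n + 1) + C ((-1 : ℂ) ^ (n + 3) * (p : ℂ)))
    (α : Fin (n+2) → ℂ) (hf : f = ∏ i, (X - C (α i))) :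
    ‖∏ i, (derivative f).eval (α i)‖
      = (p:ℝ)^(2*(n+1)) * (n+1)^(n+1) + (n+2)^(n+2) * p ^ (n+1) := by
  have h0 : ‖∏ i, α i‖ = p := by
    have : ‖f.eval 0‖ = ‖f.eval 0‖ := rfl
    nth_rw 1 [hf] at this
    rw [hfdef] at this
    simpa [eval_prod] using this
  have hd : ∀ z, (derivative f).eval z = z ^ n * ((n+2) * z + p * (n+1)) := by
    intro z; rw [hfdef, derivative_add, derivative_C]; simp; ring
  have hn : ((n:ℂ)+2) ≠ 0 := by exact_mod_cast (by omega : n + 2 ≠ 0)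
  have h1 : ∏ i, (((n:ℂ)+2) * α i + p * (n+1))
      = (-1)^(n+2) * (n+2)^(n+2) * f.eval (-((p:ℂ) * (n+1)/(n+2))) := by
    rw [hf, eval_prod, ← mul_pow]
    have : ((-1) * ((n:ℂ)+2))^(n+2) = ∏ i : Fin (n+2), ((-1) * ((n:ℂ)+2)) := by simp
    rw [this, ← Finset.prod_mul_distrib]
    refine Finset.prod_congr rfl fun i _ => ?_
    simp; field_simp; ring
  have h2 : ∏ i, (((n:ℂ)+2) * α i + p * (n+1))
      = -(((p:ℝ)^(n+2) * (n+1)^(n+1) + (n+2)^(n+2) * p : ℝ) : ℂ) := by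
    rw [h1, hfdef]
    have hs : ((-1:ℂ)^n)*(-1)^n = 1 := by rw [← mul_pow]; simp
    simp only [eval_add, eval_mul, eval_pow, eval_X, eval_C]
    rw [neg_pow ((p:ℂ) * (n+1)/(n+2)) (n+2), neg_pow ((p:ℂ) * (n+1)/(n+2)) (n+1), div_pow, div_pow]
    push_cast
    simp only [pow_succ (-1:ℂ)]
    have hpw : ((n:ℂ)+2)^n ≠ 0 := pow_ne_zero _ hn
    simp only [pow_succ, mul_pow]
    generalize (-1:ℂ)^n = s at hs ⊢
    field_simp
    linear_combination (-((p:ℂ)^n*p^2*(n+1)^n*(n+1) + p * (n+2)^n*(n+2)^2)) * hs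
  simp_rw [hd]
  rw [Finset.prod_mul_distrib, Finset.prod_pow, h2, norm_mul, norm_pow, h0, norm_neg, Complex.norm_real,
    Real.norm_of_nonneg (by positivity)]
  ring

/-- For a prime `p`, `d ≥ 2`, and the Eisenstein polynomial
`f = x^d + p x^(d-1) + (-1)^(d+1) p`, one has `M(f) < 3p`, and consequently
`M(f)^(2d-2) < (9/(d-1))^(d-1) |Δ(f)|`. -/
theorem eisenstein_mahler_bound (p : ℕ) (hp : p.Prime) (d : ℕ) (hd : 2 ≤ d)
    (f : Polynomial ℂ)
    (hfdef : f = X ^ d + C (p : ℂ) * X ^ (d - 1) + C ((-1 : ℂ) ^ (d + 1) * (p : ℂ)))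
    (α : Fin d → ℂ) (hf : f = ∏ i, (X - C (α i))) :
    (∏ i, max 1 ‖α i‖) < 3 * (p : ℝ) ∧
    (∏ i, max 1 ‖α i‖) ^ (2 * d - 2) <
      (9 / ((d : ℝ) - 1)) ^ (d - 1) *
        ‖∏ i, ∏ j ∈ univ.filter (fun j => i < j), (α i - α j) ^ 2‖ := by
  obtain ⟨n, rfl⟩ := Nat.exists_eq_add_of_le' hd
  have hM := aux_mahler p hp n f hfdef α hf
  refine ⟨hM, ?_⟩
  rw [aux_disc, ← hf, aux_val p n f hfdef α hf]
  have hp0 : (0:ℝ) < p := by exact_mod_cast hp.pos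
  have e1 : 2 * (n+2) - 2 = 2 * (n+1) := by omega
  have e2 : ((n+2 : ℕ):ℝ) - 1 = n + 1 := by push_cast; ring
  have e3 : n + 2 - 1 = n + 1 := rfl
  rw [e1, e2, e3]
  have h0 : 0 ≤ ∏ i, max 1 ‖α i‖ := Finset.prod_nonneg fun i _ => by positivity
  calc (∏ i, max 1 ‖α i‖) ^ (2 * (n+1)) ≤ (3 * (p:ℝ)) ^ (2 * (n+1)) :=
        pow_le_pow_left₀ h0 hM.le _
    _ = (9 / ((n:ℝ)+1)) ^ (n+1) * ((p:ℝ)^(2*(n+1)) * (n+1)^(n+1)) := by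
        rw [div_pow, mul_pow, pow_mul (3:ℝ)]
        norm_num
        field_simp
    _ < _ := by
        gcongr
        have : (0:ℝ) < (n+2)^(n+2) * p ^ (n+1) := by positivity
        linarith
end

section
/- Let m be a non-negative even integer, r ≥ 1 a real number, and let f(x) = (∏_{i=1}^{m/2} (x−α_i)(x−α_i′)) · (∏_{i=m/2+1}^{d−m/2} (x−α_i)) ∈ ℂ[x] be a monic polynomial of degree d ≥ 2 such that |α_i| = |α_i′| for all i = 1,…,m/2 and |α_i| ≤ r for all i = m/2+1,…,d−m/2 (i.e. all roots of modulus greater than r occur in pairs of equal modulus). Then M(f)^(2d−3) ≥ (2r)^(d(1−d)) · |Δ(f)|. -/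
open Polynomial Finset

theorem aux_big {d : ℕ} (hd : 2 ≤ d) (b : Fin d → ℝ) (hb : ∀ i, 1 ≤ b i) (p q : Fin d) (hpq : q ≠ p)
    (hmax : ∀ i, b i ≤ b p) (hq : b q = b p) :
    ∏ i, ∏ j ∈ ({i}ᶜ : Finset (Fin d)), max (b i) (b j) ≤ (∏ i, b i) ^ (2 * d - 3) := by
  have hb0 : ∀ i, 0 < b i := fun i => lt_of_lt_of_le one_pos (hb i)
  have hR0 : ∀ i, 0 ≤ ∏ j ∈ ({i}ᶜ : Finset (Fin d)), max (b i) (b j) := fun i =>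
    prod_nonneg fun j _ => le_trans (hb0 i).le (le_max_left _ _)
  have hRp : ∏ j ∈ ({p}ᶜ : Finset (Fin d)), max (b p) (b j) = b p ^ (d - 1) := by
    rw [prod_congr rfl (fun j _ => max_eq_left (hmax j)), prod_const, card_compl]
    simp
  set P := ∏ i, b i with hP
  set Q := ∏ i ∈ ({p}ᶜ : Finset (Fin d)), b i with hQ
  have hPQ : P = b p * Q := by
    rw [hP, hQ, ← Finset.prod_singleton b p, Finset.prod_mul_prod_compl]
  have hQ0 : 0 < Q := prod_pos fun i _ => hb0 i
  have hP0 : 0 < P := prod_pos fun i _ => hb0 i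
  have hQB : b p ≤ Q := by
    rw [← hq]
    have hmem : q ∈ ({p}ᶜ : Finset (Fin d)) := by simpa using hpq
    rw [hQ, ← Finset.mul_prod_erase _ _ hmem]
    have h1 : (1 : ℝ) ≤ ∏ x ∈ (({p}ᶜ : Finset (Fin d))).erase q, b x := by
      have := Finset.prod_le_prod (s := (({p}ᶜ : Finset (Fin d))).erase q)
        (f := fun _ => (1 : ℝ)) (g := b) (fun _ _ => zero_le_one) (fun i _ => hb i)
      simpa using this
    exact le_mul_of_one_le_right (hb0 q).le h1
  have hRi : ∀ i ∈ ({p}ᶜ : Finset (Fin d)),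
      (∏ j ∈ ({i}ᶜ : Finset (Fin d)), max (b i) (b j)) * b i ≤ b i ^ (d - 2) * P := by
    intro i hi
    have hip : i ≠ p := by simpa using hi
    have hmem : p ∈ ({i}ᶜ : Finset (Fin d)) := by simpa using hip.symm
    have hPi : P = b i * (b p * ∏ j ∈ (({i}ᶜ : Finset (Fin d))).erase p, b j) := by
      rw [Finset.mul_prod_erase _ _ hmem, hP]
      conv_rhs => rw [← Finset.prod_singleton b i, Finset.prod_mul_prod_compl]
    have h2 : ∏ j ∈ (({i}ᶜ : Finset (Fin d))).erase p, max (b i) (b j) ≤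
        b i ^ (d - 2) * ∏ j ∈ (({i}ᶜ : Finset (Fin d))).erase p, b j := by
      have hc : #((({i}ᶜ : Finset (Fin d))).erase p) = d - 2 := by
        rw [card_erase_of_mem hmem, card_compl]
        simp
        omega
      rw [← hc, ← prod_const, ← prod_mul_distrib]
      refine prod_le_prod (fun j _ => le_trans (hb0 i).le (le_max_left _ _)) fun j _ => ?_
      exact max_le (le_mul_of_one_le_right (hb0 i).le (hb j))
        (le_mul_of_one_le_left (hb0 j).le (hb i))
    rw [← Finset.mul_prod_erase _ _ hmem, max_eq_right (hmax i), hPi]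
    calc _ = (b p * b i) * ∏ j ∈ (({i}ᶜ : Finset (Fin d))).erase p, max (b i) (b j) := by ring
      _ ≤ (b p * b i) * (b i ^ (d - 2) * ∏ j ∈ (({i}ᶜ : Finset (Fin d))).erase p, b j) :=
        mul_le_mul_of_nonneg_left h2 (mul_pos (hb0 p) (hb0 i)).le
      _ = _ := by ring
  have hprod := prod_le_prod (fun i _ => mul_nonneg (hR0 i) (hb0 i).le) hRi
  rw [prod_mul_distrib, prod_mul_distrib, prod_const, prod_pow, ← hQ] at hprod
  have hc : #({p}ᶜ : Finset (Fin d)) = d - 1 := by rw [card_compl]; simp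
  rw [hc] at hprod
  rw [← Finset.prod_mul_prod_compl {p}, Finset.prod_singleton, hRp]
  refine le_of_mul_le_mul_right ?_ hQ0
  obtain ⟨e, rfl⟩ : ∃ e, d = e + 2 := ⟨d - 2, by omega⟩
  simp only [show e + 2 - 1 = e + 1 by omega, show e + 2 - 2 = e by omega,
    show 2 * (e + 2) - 3 = 2 * e + 1 by omega] at *
  calc _ ≤ b p ^ (e + 1) * (Q ^ e * P ^ (e + 1)) := by
        rw [mul_assoc]
        exact mul_le_mul_of_nonneg_left hprod (pow_pos (hb0 p) _).le
    _ = P ^ (2 * e + 1) * b p := by rw [hPQ]; ring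
    _ ≤ _ := mul_le_mul_of_nonneg_left hQB (pow_pos hP0 _).le

theorem aux_all {d : ℕ} (hd : 2 ≤ d) (b : Fin d → ℝ) (hb : ∀ i, 1 ≤ b i) (r : ℝ) (hr : 1 ≤ r)
    (h : ∀ p, r < b p → ∃ q, q ≠ p ∧ b q = b p) :
    ∏ i, ∏ j ∈ ({i}ᶜ : Finset (Fin d)), max (b i) (b j) ≤
      r ^ (d * (d - 1)) * (∏ i, b i) ^ (2 * d - 3) := by
  have hP1 : (1 : ℝ) ≤ ∏ i, b i := by
    have := Finset.prod_le_prod (s := (univ : Finset (Fin d)))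
      (f := fun _ => (1 : ℝ)) (g := b) (fun _ _ => zero_le_one) (fun i _ => hb i)
    simpa using this
  have hP2 := one_le_pow₀ hP1 (n := 2 * d - 3)
  have hr2 := one_le_pow₀ hr (n := d * (d - 1))
  haveI : Nonempty (Fin d) := ⟨⟨0, by omega⟩⟩
  obtain ⟨p, hp⟩ := Finite.exists_max b
  by_cases hpr : b p ≤ r
  · refine le_trans ?_ (le_mul_of_one_le_right (by positivity) hP2)
    calc _ ≤ ∏ i : Fin d, ∏ j ∈ ({i}ᶜ : Finset (Fin d)), r := by
          have h0 : ∀ i j, 0 ≤ max (b i) (b j) := fun i j =>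
            le_trans (le_trans zero_le_one (hb i)) (le_max_left _ _)
          refine prod_le_prod (fun i _ => prod_nonneg fun j _ => h0 i j) fun i _ => ?_
          exact prod_le_prod (fun j _ => h0 i j) fun j _ =>
            max_le ((hp i).trans hpr) ((hp j).trans hpr)
      _ = _ := by
          simp [card_compl, ← pow_mul, mul_comm]
  · obtain ⟨q, hq, hqp⟩ := h p (not_le.mp hpr)
    refine (aux_big hd b hb p q hq hp hqp).trans ?_
    exact le_mul_of_one_le_left (by positivity) hr2

/-- **Main theorem.** Let `m` be non-negative and even, `r ≥ 1`, and let
`f = (∏_{i=1}^{m/2} (x-αᵢ)(x-αᵢ')) (∏_{i=m/2+1}^{d-m/2} (x-αᵢ))` be a monic complex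
polynomial of degree `d ≥ 2` with `|αᵢ| = |αᵢ'|` for the paired roots and `|αᵢ| ≤ r`
for the remaining roots. Then `M(f)^(2d-3) ≥ (2r)^(d(1-d)) |Δ(f)|`.

Here the roots are listed as `α 0, α 1, …, α (d-1)` with the first `m` of them being
the `m/2` equal-modulus pairs `(α (2k), α (2k+1))`, `k = 0, …, m/2 - 1`, and all roots
`α i` with `i ≥ m` having modulus at most `r`. -/
theorem mahler_inequality_improved (d m : ℕ) (hd : 2 ≤ d) (hm : Even m) (hmd : m ≤ d)
    (r : ℝ) (hr : 1 ≤ r) (α : Fin d → ℂ) (f : Polynomial ℂ)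
    (hf : f = ∏ i, (X - C (α i)))
    (hpair : ∀ k : ℕ, ∀ hk : 2 * k + 1 < m,
      ‖α ⟨2 * k, by omega⟩‖ = ‖α ⟨2 * k + 1, by omega⟩‖)
    (hsmall : ∀ i : Fin d, m ≤ (i : ℕ) → ‖α i‖ ≤ r) :
    (∏ i, max 1 ‖α i‖) ^ (2 * d - 3) ≥
      (2 * r) ^ ((d : ℤ) * (1 - (d : ℤ))) *
        ‖∏ i, ∏ j ∈ univ.filter (fun j => i < j), (α i - α j) ^ 2‖ := by
  have hb : ∀ i, 1 ≤ max 1 ‖α i‖ := fun i => le_max_left _ _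
  have key := aux_all hd (fun i => max 1 ‖α i‖) hb r hr (by
    intro p hp
    have hp' : r < ‖α p‖ := by
      rcases lt_max_iff.mp hp with h | h
      · exact absurd h (not_lt.mpr hr)
      · exact h
    have hpm : (p : ℕ) < m := by
      by_contra hc
      exact absurd (hsmall p (not_lt.mp hc)) (not_le.mpr hp')
    obtain ⟨n, hn⟩ := hm
    rcases Nat.even_or_odd' (p : ℕ) with ⟨k, hk | hk⟩
    · have := hpair k (by omega)
      refine ⟨⟨2 * k + 1, by omega⟩, ?_, ?_⟩
      · intro h
        have := congrArg Fin.val h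
        simp at this
        omega
      · have hpe : p = ⟨2 * k, by omega⟩ := Fin.ext hk
        simp only [hpe, this]
    · have := hpair k (by omega)
      refine ⟨⟨2 * k, by omega⟩, ?_, ?_⟩
      · intro h
        have := congrArg Fin.val h
        simp at this
        omega
      · have hpe : p = ⟨2 * k + 1, by omega⟩ := Fin.ext hk
        simp only [hpe, this])
  have hnorm : ‖∏ i, ∏ j ∈ univ.filter (fun j => i < j), (α i - α j) ^ 2‖ ≤
      2 ^ (d * (d - 1)) *
        ∏ i, ∏ j ∈ ({i}ᶜ : Finset (Fin d)), max (max 1 ‖α i‖) (max 1 ‖α j‖) := by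
    have h1 : ‖∏ i, ∏ j ∈ univ.filter (fun j => i < j), (α i - α j) ^ 2‖ =
        ∏ i, ∏ j ∈ Ioi i, ‖α j - α i‖ * ‖α i - α j‖ := by
      rw [norm_prod]
      refine prod_congr rfl fun i _ => ?_
      rw [norm_prod]
      refine prod_congr (by ext; simp) fun j _ => ?_
      rw [norm_pow, norm_sub_rev (α j), sq]
    rw [h1, Finset.prod_prod_Ioi_mul_eq_prod_prod_off_diag (fun i j => ‖α i - α j‖)]
    calc _ ≤ ∏ i : Fin d, ∏ j ∈ ({i}ᶜ : Finset (Fin d)),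
          2 * max (max 1 ‖α i‖) (max 1 ‖α j‖) := by
          refine prod_le_prod (fun i _ => prod_nonneg fun j _ => norm_nonneg _) fun i _ => ?_
          refine prod_le_prod (fun j _ => norm_nonneg _) fun j _ => ?_
          have a1 := norm_sub_le (α j) (α i)
          have a2 : ‖α i‖ ≤ max (max 1 ‖α i‖) (max 1 ‖α j‖) := by simp
          have a3 : ‖α j‖ ≤ max (max 1 ‖α i‖) (max 1 ‖α j‖) := by simp
          linarith
      _ = _ := by
          simp only [prod_mul_distrib, prod_const, card_compl]
          simp [← pow_mul, mul_comm]
  have hz : (2 * r) ^ ((d : ℤ) * (1 - (d : ℤ))) = ((2 * r) ^ (d * (d - 1)))⁻¹ := by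
    rw [← zpow_natCast, ← zpow_neg]
    congr 1
    rw [Nat.cast_mul, Nat.cast_sub (by omega)]
    push_cast
    ring
  rw [hz, ge_iff_le, inv_mul_le_iff₀ (by positivity), mul_pow, mul_assoc]
  exact hnorm.trans (mul_le_mul_of_nonneg_left key (by positivity))
end

section
/- Let K be a number field of degree d with at least one non-real embedding K → ℂ. Then there exists a constant c_K > 0, depending only on K, such that there are infinitely many α ∈ O_K with K = ℚ(α), M(f_{α,ℤ})^(2d−3) ≤ c_K · |Δ(f_{α,ℤ})|, and all roots of f_{α,ℤ} in ℂ, except one pair of complex conjugate roots, have modulus at most c_K. -/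
open Polynomial Finset

lemma aux_prod_ite {ι : Type*} [DecidableEq ι] (s : Finset ι) (a b : ι) (hab : a ≠ b)
    (ha : a ∈ s) (hb : b ∈ s) (x y : ℝ) :
    ∏ i ∈ s, (if i = a ∨ i = b then x else y) = x ^ 2 * y ^ (#s - 2) := by
  have h1 : s.filter (fun i => i = a ∨ i = b) = {a, b} := by
    ext i; simp only [mem_filter, mem_insert, mem_singleton]
    constructor
    · exact fun h => h.2
    · rintro (rfl | rfl) <;> simp [ha, hb]
  have h2 := Finset.card_filter_add_card_filter_not (s := s) (fun i => i = a ∨ i = b)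
  rw [h1, Finset.card_pair hab] at h2
  rw [Finset.prod_ite, Finset.prod_const, Finset.prod_const, h1, Finset.card_pair hab]
  congr 2
  omega

lemma aux_disc_s7 (d : ℕ) (β : Fin d → ℂ) (a b : Fin d) (hab : a ≠ b) (r : ℝ) (hr : 1 ≤ r)
    (h1 : ∀ i j, i ≠ j → 1 ≤ ‖β i - β j‖)
    (ha : ∀ j, j ≠ a → r ≤ ‖β a - β j‖) (hb : ∀ j, j ≠ b → r ≤ ‖β b - β j‖) :
    (r ^ 2) ^ (2 * d - 3) ≤
      ‖∏ i, ∏ j ∈ univ.filter (fun j => i < j), (β i - β j) ^ 2‖ := by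
  have hd : 2 ≤ d := by
    have := a.2; have := b.2
    have : (a : ℕ) ≠ b := fun h => hab (Fin.ext h)
    omega
  have e1 : ‖∏ i, ∏ j ∈ univ.filter (fun j => i < j), (β i - β j) ^ 2‖
      = ∏ i, ∏ j ∈ ({i}ᶜ : Finset (Fin d)), ‖β j - β i‖ := by
    rw [← Finset.prod_prod_Ioi_mul_eq_prod_prod_off_diag (fun j i => ‖β j - β i‖)]
    simp only [norm_prod, norm_pow]
    refine Finset.prod_congr rfl fun i _ => ?_
    refine Finset.prod_congr (by ext; simp) fun j _ => ?_
    rw [norm_sub_rev (β j), sq]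
  rw [e1]
  have e2 : (r ^ 2) ^ (2 * d - 3) =
      ∏ i : Fin d, (if i = a ∨ i = b then r ^ (d - 1) else r ^ 2) := by
    rw [aux_prod_ite _ a b hab (mem_univ _) (mem_univ _)]
    simp only [card_univ, Fintype.card_fin, ← pow_mul, ← pow_add]
    congr 1; omega
  rw [e2]
  refine Finset.prod_le_prod (fun i _ => by split_ifs <;> positivity) fun i _ => ?_
  split_ifs with h
  · have : r ^ (d - 1) = ∏ j ∈ ({i}ᶜ : Finset (Fin d)), r := by
      simp [Finset.card_compl]
    rw [this]
    refine Finset.prod_le_prod (fun _ _ => by positivity) fun j hj => ?_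
    simp only [mem_compl, mem_singleton] at hj
    rw [norm_sub_rev]
    rcases h with rfl | rfl
    · exact ha j hj
    · exact hb j hj
  · push Not at h
    have := aux_prod_ite ({i}ᶜ : Finset (Fin d)) a b hab (by simpa using h.1.symm)
      (by simpa using h.2.symm) r 1
    rw [one_pow, mul_one] at this
    rw [← this]
    refine Finset.prod_le_prod (fun i _ => by split_ifs <;> positivity) fun j hj => ?_
    simp only [mem_compl, mem_singleton] at hj
    split_ifs with h'
    · rcases h' with rfl | rfl
      · exact ha i h.1
      · exact hb i h.2
    · exact h1 j i hj

lemma aux_mahler_s7 (d : ℕ) (β : Fin d → ℂ) (a b : Fin d) (hab : a ≠ b) (B r : ℝ) (hB : 1 ≤ B)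
    (hr : 1 ≤ r) (h1 : ∀ i, i ≠ a → i ≠ b → ‖β i‖ ≤ B)
    (ha : ‖β a‖ ≤ B * r) (hb : ‖β b‖ ≤ B * r) :
    ∏ i, max 1 ‖β i‖ ≤ B ^ d * r ^ 2 := by
  have e := aux_prod_ite (univ : Finset (Fin d)) a b hab (mem_univ _) (mem_univ _) r 1
  rw [one_pow, mul_one] at e
  have e2 : B ^ d * r ^ 2 = ∏ i : Fin d, (B * if i = a ∨ i = b then r else 1) := by
    rw [Finset.prod_mul_distrib, e]; simp
  rw [e2]
  refine Finset.prod_le_prod (fun i _ => by positivity) fun i _ => ?_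
  split_ifs with h
  · refine max_le (by nlinarith) ?_
    rcases h with rfl | rfl
    · exact ha
    · exact hb
  · push Not at h
    rw [mul_one]
    exact max_le hB (h1 i h.1 h.2)

open NumberField NumberField.InfinitePlace NumberField.mixedEmbedding in
open scoped Classical in
lemma aux_lattice (K : Type*) [Field K] [NumberField K] :
    ∃ C : ℝ, 0 ≤ C ∧ ∀ x : mixedSpace K, ∃ α : 𝓞 K, ‖mixedEmbedding K (α : K) - x‖ ≤ C := by
  refine ⟨∑ i, ‖latticeBasis K i‖, by positivity, fun x => ?_⟩
  obtain ⟨a, h2⟩ := (mem_span_latticeBasis K).1 (ZSpan.floor (latticeBasis K) x).2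
  refine ⟨a, ?_⟩
  have := ZSpan.norm_fract_le (latticeBasis K) x
  rw [ZSpan.fract_apply, norm_sub_rev, ← h2] at this
  exact this

open NumberField NumberField.InfinitePlace NumberField.mixedEmbedding in
open scoped Classical in
lemma aux_approx (K : Type*) [Field K] [NumberField K] :
    ∃ C : ℝ, 0 ≤ C ∧ ∀ n : InfinitePlace K → ℝ, (∀ w, 0 ≤ n w) → ∃ α : 𝓞 K,
      ∀ φ : K →+* ℂ, |(φ α).re - n (mk φ)| ≤ C ∧ |(φ α).im| ≤ n (mk φ) + C ∧
        (¬ ComplexEmbedding.IsReal φ → n (mk φ) - C ≤ |(φ α).im|) := by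
  obtain ⟨C, hC, h⟩ := aux_lattice K
  refine ⟨C, hC, fun n hn => ?_⟩
  obtain ⟨α, hα⟩ := h (fun w => n w, fun w => ⟨n w, n w⟩)
  refine ⟨α, ?_⟩
  have hr : ∀ w : {w : InfinitePlace K // w.IsReal},
      |embedding_of_isReal w.2 (α : K) - n w| ≤ C := fun w =>
    ((norm_le_pi_norm _ w).trans (norm_fst_le _)).trans hα
  have hc : ∀ w : {w : InfinitePlace K // w.IsComplex},
      ‖w.1.embedding (α : K) - ⟨n w, n w⟩‖ ≤ C := fun w =>
    ((norm_le_pi_norm _ w).trans (norm_snd_le _)).trans hα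
  have key : ∀ w : InfinitePlace K,
      |(w.embedding (α : K)).re - n w| ≤ C ∧ |(w.embedding (α : K)).im| ≤ n w + C ∧
        (¬ ComplexEmbedding.IsReal w.embedding → n w - C ≤ |(w.embedding (α : K)).im|) := by
    intro w
    by_cases hw : w.IsReal
    · have := hr ⟨w, hw⟩
      have e1 := embedding_of_isReal_apply hw (α : K)
      have e2 := congrArg Complex.re e1
      have e3 := congrArg Complex.im e1
      rw [Complex.ofReal_re] at e2
      rw [Complex.ofReal_im] at e3
      refine ⟨by rw [← e2]; exact this, ?_, fun h => absurd (isReal_iff.1 hw) h⟩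
      have := hn w
      rw [← e3, abs_zero]; linarith
    · have h := hc ⟨w, not_isReal_iff_isComplex.1 hw⟩
      have h1 := (Complex.abs_re_le_norm _).trans h
      have h2 := (Complex.abs_im_le_norm _).trans h
      simp only [Complex.sub_re, Complex.sub_im] at h1 h2
      have h3 := abs_le.1 h2
      refine ⟨h1, abs_le.2 ⟨?_, ?_⟩, fun _ => le_abs.2 (Or.inl ?_)⟩ <;> linarith [hn w]
  intro φ
  have k := key (mk φ)
  rcases mk_eq_iff.1 (mk_embedding (mk φ)) with h | h
  · rwa [h] at k
  · have e : (mk φ).embedding = ComplexEmbedding.conjugate φ := by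
      rw [← h]; simp
    rw [e] at k
    simpa [ComplexEmbedding.isReal_conjugate_iff] using k

open NumberField in
lemma aux_adjoin (K : Type*) [Field K] [NumberField K] (α : K)
    (h : ∀ φ ψ : K →+* ℂ, φ α = ψ α → φ = ψ) : Algebra.adjoin ℚ {α} = ⊤ := by
  have h1 : IntermediateField.adjoin ℚ {α} = ⊤ := by
    rw [Field.primitive_element_iff_algHom_eq_of_eval' ℚ ℂ
      (fun x => IsAlgClosed.splits _) α]
    intro φ ψ hh
    have := h φ.toRingHom ψ.toRingHom hh
    ext x
    exact RingHom.congr_fun this x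
  rw [← IntermediateField.adjoin_simple_toSubalgebra_of_isAlgebraic
    (Algebra.IsAlgebraic.isAlgebraic α), h1]
  rfl

open NumberField in
lemma aux_roots (K : Type*) [Field K] [NumberField K] (d : ℕ) (hd : d = Module.finrank ℚ K)
    (α : 𝓞 K) (h : ∀ φ ψ : K →+* ℂ, φ α = ψ α → φ = ψ) (β : Fin d → ℂ)
    (hβ : (minpoly ℤ α).map (algebraMap ℤ ℂ) = ∏ i, (X - C (β i))) :
    ∃ e : Fin d ≃ (K →+* ℂ), ∀ i, β i = e i α := by
  have h1 : ∀ φ : K →+* ℂ, ∃ i, φ α = β i := by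
    intro φ
    have : ((minpoly ℤ α).map (algebraMap ℤ ℂ)).eval (φ α) = 0 := by
      have h0 := minpoly.aeval ℤ α
      have h2 := congrArg (fun x : 𝓞 K => φ (x : K)) h0
      rw [eval_map]
      have h3 := Polynomial.hom_eval₂ (minpoly ℤ α) (algebraMap ℤ (𝓞 K))
        (φ.comp (algebraMap (𝓞 K) K)) α
      rw [Subsingleton.elim (algebraMap ℤ ℂ) ((φ.comp (algebraMap (𝓞 K) K)).comp (algebraMap ℤ (𝓞 K)))]
      refine Eq.trans h3.symm ?_
      simpa [aeval_def] using h2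
    rw [hβ, eval_prod, Finset.prod_eq_zero_iff] at this
    obtain ⟨i, -, hi⟩ := this
    exact ⟨i, by simpa [sub_eq_zero] using hi⟩
  choose f hf using h1
  have hinj : Function.Injective f := fun φ ψ hh => h φ ψ (by rw [hf, hf, hh])
  have hcard : Fintype.card (K →+* ℂ) = Fintype.card (Fin d) := by
    rw [Embeddings.card, Fintype.card_fin, hd]
  have hbij := (Fintype.bijective_iff_injective_and_card f).2 ⟨hinj, hcard⟩
  refine ⟨(Equiv.ofBijective f hbij).symm, fun i => ?_⟩
  rw [hf]
  congr 1
  exact ((Equiv.ofBijective f hbij).apply_symm_apply i).symm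

open NumberField NumberField.InfinitePlace in
lemma aux_exists (K : Type*) [Field K] [NumberField K] (φ₀ : K →+* ℂ) :
    ∃ B : ℝ, 1 ≤ B ∧ ∀ M : ℝ, ∃ r : ℝ, 1 ≤ r ∧ M ≤ r ∧ ∃ α : 𝓞 K,
      r ≤ ‖φ₀ α‖ ∧ (∀ φ : K →+* ℂ, mk φ ≠ mk φ₀ → ‖φ α‖ ≤ B) ∧
      (∀ φ : K →+* ℂ, mk φ = mk φ₀ → ‖φ α‖ ≤ B * r) ∧
      (∀ φ ψ : K →+* ℂ, φ ≠ ψ → 1 ≤ ‖φ α - ψ α‖) ∧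
      (∀ φ ψ : K →+* ℂ, φ ≠ ψ → mk φ = mk φ₀ → r ≤ ‖φ α - ψ α‖) := by
  classical
  obtain ⟨C, hC, happ⟩ := aux_approx K
  set m : ℝ := (Fintype.card (InfinitePlace K) : ℝ) with hm
  have hm0 : 1 ≤ m := by
    rw [hm]
    exact_mod_cast Fintype.card_pos
  let D : ℝ := 2 * C + 2
  have hDdef : D = 2 * C + 2 := rfl
  have hDm : D ≤ D * m := by nlinarith
  refine ⟨3 * D * m, by nlinarith, fun M => ?_⟩
  let r : ℝ := max M (2 * m + 2)
  have hr2 : 2 * m + 2 ≤ r := le_max_right _ _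
  have hrM : M ≤ r := le_max_left _ _
  have hr1 : 1 ≤ r := by linarith
  refine ⟨r, hr1, hrM, ?_⟩
  let e := Fintype.equivFin (InfinitePlace K)
  let k : InfinitePlace K → ℝ := fun w => if w = mk φ₀ then r else ((e w : ℕ) : ℝ) + 1
  have hk0 : k (mk φ₀) = r := by simp [k]
  have hkm : ∀ w, w ≠ mk φ₀ → k w ≤ m := by
    intro w hw
    simp only [k, hw, if_false, hm]
    exact_mod_cast (e w).2
  have hk1 : ∀ w, 1 ≤ k w := by
    intro w
    simp only [k]; split_ifs
    · exact hr1
    · simp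
  have hkr : ∀ w, w ≠ mk φ₀ → 1 ≤ |k w - r| ∧ r ≤ D * |k w - r| - 2 * C := by
    intro w hw
    have := hkm w hw
    have h5 : r - m ≤ |k w - r| := by
      rw [abs_sub_comm]; exact (by linarith : r - m ≤ r - k w).trans (le_abs_self _)
    constructor
    · linarith
    · nlinarith
  have hsep : ∀ w w', w ≠ w' → 1 ≤ |k w - k w'| := by
    intro w w' hw
    by_cases h1 : w = mk φ₀
    · rw [h1, hk0, abs_sub_comm]; exact (hkr w' (by rw [← h1]; exact hw.symm)).1
    by_cases h2 : w' = mk φ₀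
    · rw [h2, hk0]; exact (hkr w h1).1
    simp only [k, h1, h2, if_false]
    have h3 : ((e w : ℕ) : ℤ) - ((e w' : ℕ) : ℤ) ≠ 0 := by
      intro h
      apply hw
      apply e.injective
      apply Fin.ext
      omega
    have := Int.one_le_abs h3
    rw [add_sub_add_right_eq_sub]
    exact_mod_cast this
  obtain ⟨α, hα⟩ := happ (fun w => D * k w) (fun w => by have := hk1 w; positivity)
  -- difference bounds
  have hre : ∀ φ ψ : K →+* ℂ, D * |k (mk φ) - k (mk ψ)| - 2 * C ≤ ‖φ α - ψ α‖ := by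
    intro φ ψ
    refine le_trans ?_ (Complex.abs_re_le_norm _)
    rw [Complex.sub_re]
    have h1 := abs_le.1 (hα φ).1
    have h2 := abs_le.1 (hα ψ).1
    have h3 : D * |k (mk φ) - k (mk ψ)| = |D * k (mk φ) - D * k (mk ψ)| := by
      rw [← mul_sub, abs_mul, abs_of_pos (by linarith : 0 < D)]
    rw [h3, sub_le_iff_le_add]
    refine abs_le.2 ⟨?_, ?_⟩
    · linarith [neg_abs_le ((φ α).re - (ψ α).re)]
    · linarith [le_abs_self ((φ α).re - (ψ α).re)]
  have him : ∀ φ ψ : K →+* ℂ, φ ≠ ψ → mk φ = mk ψ → k (mk φ) ≤ ‖φ α - ψ α‖ := by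
    intro φ ψ hne h
    rcases mk_eq_iff.1 h with h | h
    · exact absurd h hne
    have hnr : ¬ ComplexEmbedding.IsReal φ := by
      intro h'
      exact hne (by rw [← h, ComplexEmbedding.isReal_iff.1 h'])
    have h3 := (hα φ).2.2 hnr
    refine le_trans ?_ (Complex.abs_im_le_norm _)
    rw [← h, ComplexEmbedding.conjugate_coe_eq, Complex.sub_im, Complex.conj_im, sub_neg_eq_add,
      ← two_mul, abs_mul, abs_two]
    have := hk1 (mk φ)
    nlinarith
  have hup : ∀ φ : K →+* ℂ, ‖φ α‖ ≤ 3 * D * k (mk φ) := by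
    intro φ
    have h1 := abs_le.1 (hα φ).1
    have h2 := (hα φ).2.1
    have h0 := hk1 (mk φ)
    have h3 : |(φ α).re| ≤ D * k (mk φ) + C := by
      refine abs_le.2 ⟨?_, ?_⟩ <;> nlinarith
    have := Complex.norm_le_abs_re_add_abs_im (φ α)
    nlinarith
  refine ⟨α, ?_, ?_, ?_, ?_, ?_⟩
  · refine le_trans ?_ (Complex.abs_re_le_norm _)
    refine le_trans ?_ (le_abs_self _)
    have h1 := abs_le.1 (hα φ₀).1
    simp only [hk0] at h1
    nlinarith
  · intro φ hφ
    refine (hup φ).trans ?_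
    have := hkm _ hφ
    gcongr
  · intro φ hφ
    refine (hup φ).trans ?_
    rw [hφ, hk0]
    nlinarith
  · intro φ ψ hne
    by_cases h : mk φ = mk ψ
    · exact (hk1 _).trans (him φ ψ hne h)
    · have := hsep _ _ h
      have := hre φ ψ
      nlinarith
  · intro φ ψ hne hφ
    by_cases h : mk φ = mk ψ
    · have := him φ ψ hne h
      rwa [hφ, hk0] at this
    · have h1 := hre φ ψ
      have h2 := (hkr (mk ψ) (by rw [← hφ]; exact fun h' => h h'.symm)).2
      rw [hφ, hk0, abs_sub_comm] at h1
      linarith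

/-- **Proposition.** Let `K` be a number field of degree `d` with a non-real embedding.
Then there exists `c_K > 0` depending only on `K` such that there are infinitely many
`α ∈ O_K` with `K = ℚ(α)`, `M(f_{α,ℤ})^(2d-3) ≤ c_K |Δ(f_{α,ℤ})|`, and all roots of
`f_{α,ℤ}`, except one pair of complex conjugate roots, have modulus at most `c_K`. -/
theorem small_generators_complex (K : Type*) [Field K] [NumberField K]
    (d : ℕ) (hd : d = Module.finrank ℚ K)
    (hcx : ∃ σ : K →+* ℂ, ¬ NumberField.ComplexEmbedding.IsReal σ) :
    ∃ cK : ℝ, 0 < cK ∧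
      {α : NumberField.RingOfIntegers K |
        Algebra.adjoin ℚ {(α : K)} = ⊤ ∧
        ∀ β : Fin d → ℂ,
          (minpoly ℤ α).map (algebraMap ℤ ℂ) = ∏ i, (X - C (β i)) →
            (∏ i, max 1 ‖β i‖) ^ (2 * d - 3) ≤
              cK * ‖∏ i, ∏ j ∈ univ.filter (fun j => i < j), (β i - β j) ^ 2‖ ∧
            ∃ i j : Fin d, i ≠ j ∧ β j = starRingEnd ℂ (β i) ∧
              ∀ l : Fin d, l ≠ i → l ≠ j → ‖β l‖ ≤ cK}.Infinite := by
  obtain ⟨φ₀, hφ₀⟩ := hcx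
  obtain ⟨B, hB, hex⟩ := aux_exists K φ₀
  refine ⟨B + (B ^ d) ^ (2 * d - 3), by positivity, fun hfin => ?_⟩
  obtain ⟨M, hM⟩ := (hfin.image (fun α : NumberField.RingOfIntegers K => ‖φ₀ (α : K)‖)).bddAbove
  obtain ⟨r, hr1, hrM, α, hlow, hoth, hmain, hsep, hsep0⟩ := hex (M + 1)
  refine absurd (hM ⟨α, ?_, rfl⟩) (not_le.2 (by simp only; linarith))
  have hinj : ∀ φ ψ : K →+* ℂ, φ α = ψ α → φ = ψ := by
    intro φ ψ h
    by_contra hne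
    have := hsep φ ψ hne
    rw [h, sub_self, norm_zero] at this
    linarith
  refine ⟨aux_adjoin K α hinj, fun β hβ => ?_⟩
  obtain ⟨e, he⟩ := aux_roots K d hd α hinj β hβ
  let φ₁ := NumberField.ComplexEmbedding.conjugate φ₀
  have hmk : NumberField.InfinitePlace.mk φ₁ = NumberField.InfinitePlace.mk φ₀ :=
    NumberField.InfinitePlace.mk_conjugate_eq φ₀
  have hne : φ₀ ≠ φ₁ := fun h => hφ₀ (NumberField.ComplexEmbedding.isReal_iff.2 h.symm)
  have hab : e.symm φ₀ ≠ e.symm φ₁ := fun h => hne (e.symm.injective h)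
  have hsm : ∀ l : Fin d, l ≠ e.symm φ₀ → l ≠ e.symm φ₁ → ‖β l‖ ≤ B := by
    intro l h0 h1
    rw [he]
    refine hoth _ fun h => ?_
    rcases NumberField.InfinitePlace.mk_eq_iff.1 h.symm with h | h
    · exact h0 (by rw [h]; simp)
    · exact h1 (by simp only [φ₁]; rw [h]; simp)
  have hM1 := aux_mahler_s7 d β _ _ hab B r hB hr1 hsm
    (by rw [he, e.apply_symm_apply]; exact hmain _ rfl)
    (by rw [he, e.apply_symm_apply]; exact hmain _ hmk)
  have hD := aux_disc_s7 d β _ _ hab r hr1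
    (fun i j hij => by rw [he, he]; exact hsep _ _ (fun h => hij (e.injective h)))
    (fun j hj => by
      rw [he, he, e.apply_symm_apply]
      exact hsep0 _ _ (fun h => hj (by rw [h]; simp)) rfl)
    (fun j hj => by
      rw [he, he, e.apply_symm_apply]
      exact hsep0 _ _ (fun h => hj (by rw [h]; simp)) hmk)
  refine ⟨?_, e.symm φ₀, e.symm φ₁, hab, ?_, fun l h0 h1 => (hsm l h0 h1).trans ?_⟩
  · calc (∏ i, max 1 ‖β i‖) ^ (2 * d - 3) ≤ (B ^ d * r ^ 2) ^ (2 * d - 3) := by gcongr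
      _ = (B ^ d) ^ (2 * d - 3) * (r ^ 2) ^ (2 * d - 3) := mul_pow _ _ _
      _ ≤ (B + (B ^ d) ^ (2 * d - 3)) * _ := by
        refine mul_le_mul ?_ hD (by positivity) (by positivity)
        linarith
  · rw [he, he, e.apply_symm_apply, e.apply_symm_apply]
    rfl
  · have : 0 ≤ (B ^ d) ^ (2 * d - 3) := by positivity
    linarith
end

section
/- Let K be a number field of degree d ≥ 2 with at least one real embedding K → ℝ. Then there exists a constant c_K > 0, depending only on K, such that there are infinitely many α ∈ O_K with K = ℚ(α), M(f_{α,ℤ})^(2d−2) ≤ c_K · |Δ(f_{α,ℤ})|, and all roots of f_{α,ℤ} in ℂ, except one, have modulus at most c_K. -/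
open Polynomial Finset

open NumberField in
/-- Every prescribed vector of values at the infinite places is within a bounded distance of the
vector of an algebraic integer. -/
lemma sg_cover (K : Type*) [Field K] [NumberField K] :
    ∃ C : ℝ, 0 ≤ C ∧ ∀ (t : InfinitePlace K → ℝ) (R : ℝ), ∃ α : 𝓞 K, ∀ φ : K →+* ℂ,
      |(φ (α : K)).re - t (InfinitePlace.mk φ)| ≤ C ∧
      (ComplexEmbedding.IsReal φ → (φ (α : K)).im = 0) ∧
      (¬ ComplexEmbedding.IsReal φ → |(|(φ (α : K)).im| - |R|)| ≤ C) := by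
  classical
  set b := mixedEmbedding.latticeBasis K with hb
  refine ⟨∑ i, ‖b i‖, by positivity, fun t R => ?_⟩
  let m : mixedEmbedding.mixedSpace K := (fun w => t w.1, fun w => ⟨t w.1, R⟩)
  have hfl := (ZSpan.floor b m).2
  rw [mixedEmbedding.mem_span_latticeBasis] at hfl
  obtain ⟨α, hα⟩ : ∃ α : 𝓞 K, mixedEmbedding K (α : K) = (ZSpan.floor b m : mixedEmbedding.mixedSpace K) := by
    obtain ⟨α, hα⟩ := hfl
    exact ⟨α, by simpa using hα⟩
  have hle := ZSpan.norm_fract_le b m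
  set S := ∑ i, ‖b i‖
  have hle' : ‖m - mixedEmbedding K (α : K)‖ ≤ S := by
    rw [hα]; simpa [ZSpan.fract] using hle
  refine ⟨α, fun φ => ?_⟩
  have h1 : ∀ w : {w : InfinitePlace K // w.IsReal},
      |t w.1 - InfinitePlace.embedding_of_isReal w.2 (α : K)| ≤ S := fun w => by
    have := ((norm_le_pi_norm _ w).trans (norm_fst_le (m - mixedEmbedding K (α : K)))).trans hle'
    simpa [m, mixedEmbedding.mixedEmbedding_apply_isReal] using this
  have h2 : ∀ w : {w : InfinitePlace K // w.IsComplex},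
      ‖(⟨t w.1, R⟩ : ℂ) - w.1.embedding (α : K)‖ ≤ S := fun w => by
    have := ((norm_le_pi_norm _ w).trans (norm_snd_le (m - mixedEmbedding K (α : K)))).trans hle'
    simpa [m, mixedEmbedding.mixedEmbedding_apply_isComplex] using this
  by_cases hφ : ComplexEmbedding.IsReal φ
  · have h := h1 ⟨InfinitePlace.mk φ, InfinitePlace.isReal_mk_iff.2 hφ⟩
    have e := InfinitePlace.embedding_of_isReal_apply (InfinitePlace.isReal_mk_iff.2 hφ) (α : K)
    rw [InfinitePlace.embedding_mk_eq_of_isReal hφ] at e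
    rw [← e]
    refine ⟨?_, fun _ => Complex.ofReal_im _, fun h => absurd hφ h⟩
    rw [abs_sub_comm, Complex.ofReal_re]; exact h
  · have h := h2 ⟨InfinitePlace.mk φ, InfinitePlace.isComplex_mk_iff.2 hφ⟩
    have hre := (Complex.abs_re_le_norm _).trans h
    have him := (Complex.abs_im_le_norm _).trans h
    rw [abs_sub_comm] at *
    simp only [Complex.sub_re, Complex.sub_im] at hre him
    have him' := (abs_abs_sub_abs_le _ _).trans him
    rcases InfinitePlace.embedding_mk_eq φ with e | e
    · rw [e] at hre him'
      exact ⟨hre, fun h => absurd h hφ, fun _ => by rw [abs_sub_comm]; exact him'⟩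
    · rw [e] at hre him'
      simp only [ComplexEmbedding.conjugate_coe_eq, Complex.conj_re, Complex.conj_im, abs_neg]
        at hre him'
      exact ⟨hre, fun h => absurd h hφ, fun _ => by rw [abs_sub_comm]; exact him'⟩

open NumberField in
lemma sg_values (K : Type*) [Field K] [NumberField K] (φ₀ : K →+* ℂ)
    (h₀ : ComplexEmbedding.IsReal φ₀) :
    ∃ C : ℝ, 1 ≤ C ∧ ∀ T : ℝ, C + 1 ≤ T → ∃ α : 𝓞 K, 
      (∀ φ ψ : K →+* ℂ, φ ≠ ψ → 1 ≤ ‖φ (α : K) - ψ (α : K)‖) ∧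
      (∀ φ : K →+* ℂ, φ ≠ φ₀ → ‖φ (α : K)‖ ≤ C) ∧ T ≤ ‖φ₀ (α : K)‖ := by
  classical
  obtain ⟨C, hC, h⟩ := sg_cover K
  let e := Fintype.equivFin (InfinitePlace K)
  set n := Fintype.card (InfinitePlace K)
  set R := 2 * C + 1 with hR
  have hR1 : 1 ≤ R := by linarith
  refine ⟨R * n + R + 2 * C, by nlinarith [(Nat.cast_nonneg n : (0:ℝ) ≤ n)], fun T hT => ?_⟩
  obtain ⟨α, hα⟩ := h (fun w => if w = InfinitePlace.mk φ₀ then T + C else R * (e w : ℕ)) R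
  have hmk : ∀ φ : K →+* ℂ, φ ≠ φ₀ → InfinitePlace.mk φ ≠ InfinitePlace.mk φ₀ := by
    intro φ hφ hh
    rcases InfinitePlace.mk_eq_iff.1 hh.symm with h | h
    · exact hφ h.symm
    · exact hφ (by rw [← h, ComplexEmbedding.isReal_iff.1 h₀])
  have hre : ∀ φ : K →+* ℂ, φ ≠ φ₀ →
      |(φ (α : K)).re - R * (e (InfinitePlace.mk φ) : ℕ)| ≤ C := fun φ hφ => by
    have := (hα φ).1
    simpa [hmk φ hφ] using this
  have hbd : ∀ φ : K →+* ℂ, φ ≠ φ₀ → ‖φ (α : K)‖ ≤ R * n + R + 2 * C := fun φ hφ => by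
    have h1 := hre φ hφ
    have h2 : ((e (InfinitePlace.mk φ) : ℕ) : ℝ) ≤ n := by
      exact_mod_cast (e (InfinitePlace.mk φ)).2.le
    have h2' : R * ((e (InfinitePlace.mk φ) : ℕ) : ℝ) ≤ R * n := by gcongr
    have h20 : 0 ≤ R * ((e (InfinitePlace.mk φ) : ℕ) : ℝ) := by positivity
    have h3 : |(φ (α : K)).im| ≤ R + C := by
      by_cases hr : ComplexEmbedding.IsReal φ
      · rw [(hα φ).2.1 hr]; simp; linarith
      · have := abs_le.1 ((hα φ).2.2 hr)
        rw [abs_of_nonneg (by linarith : 0 ≤ R)] at this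
        linarith [this.2]
    have h4 : |(φ (α : K)).re| ≤ R * n + C := by
      rw [abs_le] at h1 ⊢
      constructor <;> linarith [h1.1, h1.2]
    linarith [Complex.norm_le_abs_re_add_abs_im (φ (α : K))]
  have hbig : T ≤ ‖φ₀ (α : K)‖ := by
    have h1 := (hα φ₀).1
    simp only [if_true] at h1
    have := (abs_le.1 h1).1
    have h3 := le_abs_self (φ₀ (α : K)).re
    linarith [Complex.abs_re_le_norm (φ₀ (α : K))]
  refine ⟨α, fun φ ψ hne => ?_, hbd, hbig⟩
  by_cases h1 : φ = φ₀
  · subst h1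
    linarith [norm_sub_norm_le (φ (α : K)) (ψ (α : K)), hbd ψ hne.symm]
  by_cases h2 : ψ = φ₀
  · subst h2
    rw [norm_sub_rev]
    linarith [norm_sub_norm_le (ψ (α : K)) (φ (α : K)), hbd φ hne]
  by_cases hm : InfinitePlace.mk φ = InfinitePlace.mk ψ
  · rcases InfinitePlace.mk_eq_iff.1 hm with h | h
    · exact absurd h hne
    · have hr : ¬ ComplexEmbedding.IsReal φ := fun hr =>
        hne (by rw [← h, ComplexEmbedding.isReal_iff.1 hr])
      have := (abs_le.1 ((hα φ).2.2 hr)).1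
      rw [abs_of_nonneg (by linarith : 0 ≤ R)] at this
      refine le_trans ?_ (Complex.abs_im_le_norm _)
      rw [← h]
      simp only [ComplexEmbedding.conjugate_coe_eq, Complex.sub_im, Complex.conj_im, sub_neg_eq_add,
        ← two_mul, abs_mul, abs_two]
      linarith
  · have a1 := abs_le.1 (hre φ h1)
    have a2 := abs_le.1 (hre ψ h2)
    refine le_trans ?_ (Complex.abs_re_le_norm _)
    rw [Complex.sub_re]
    have hne' : (e (InfinitePlace.mk φ) : ℕ) ≠ e (InfinitePlace.mk ψ) := fun hh =>
      hm (e.injective (Fin.ext hh))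
    rcases lt_or_gt_of_ne hne' with hl | hl
    · have : ((e (InfinitePlace.mk φ) : ℕ) : ℝ) + 1 ≤ (e (InfinitePlace.mk ψ) : ℕ) := by
        exact_mod_cast hl
      have := mul_le_mul_of_nonneg_left this (by linarith : 0 ≤ R)
      rw [le_abs]; right; linarith [a1.1, a1.2, a2.1, a2.2]
    · have : ((e (InfinitePlace.mk ψ) : ℕ) : ℝ) + 1 ≤ (e (InfinitePlace.mk φ) : ℕ) := by
        exact_mod_cast hl
      have := mul_le_mul_of_nonneg_left this (by linarith : 0 ≤ R)
      rw [le_abs]; left; linarith [a1.1, a1.2, a2.1, a2.2]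

lemma sg_disc {d : ℕ} (β : Fin d → ℂ) (i₀ : Fin d) (C : ℝ) (hC : 1 ≤ C)
    (hsep : ∀ i j, i ≠ j → 1 ≤ ‖β i - β j‖) (hbd : ∀ i, i ≠ i₀ → ‖β i‖ ≤ C)
    (hbig : 2 * C ≤ ‖β i₀‖) :
    (∏ i, max 1 ‖β i‖) ^ (2 * d - 2) ≤ (2 * C ^ (d - 1)) ^ (2 * d - 2) *
      ‖∏ i, ∏ j ∈ univ.filter (fun j => i < j), (β i - β j) ^ 2‖ := by
  classical
  set A := ‖β i₀‖ with hA
  have hcard : ∀ i : Fin d, ({i}ᶜ : Finset (Fin d)).card = d - 1 := fun i => by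
    simp [card_compl]
  have hM : ∏ i, max 1 ‖β i‖ ≤ A * C ^ (d - 1) := by
    rw [Fintype.prod_eq_mul_prod_compl i₀]
    have h1 : max 1 ‖β i₀‖ = A := max_eq_right (by linarith)
    rw [h1]
    gcongr
    calc ∏ i ∈ {i₀}ᶜ, max 1 ‖β i‖ ≤ ∏ i ∈ ({i₀}ᶜ : Finset (Fin d)), C :=
          prod_le_prod (fun _ _ => by positivity) (fun i hi => max_le hC (hbd i (by simpa using hi)))
      _ = C ^ (d - 1) := by rw [prod_const, hcard]
  have hD : ‖∏ i, ∏ j ∈ univ.filter (fun j => i < j), (β i - β j) ^ 2‖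
      = ∏ i, ∏ j ∈ {i}ᶜ, ‖β j - β i‖ := by
    rw [← prod_prod_Ioi_mul_eq_prod_prod_off_diag (fun i j => ‖β i - β j‖), norm_prod]
    refine prod_congr rfl fun i _ => ?_
    rw [norm_prod]
    refine prod_congr (by ext; simp) fun j _ => ?_
    rw [norm_pow, norm_sub_rev (β j), sq]
  have hhalf : ∀ i, i ≠ i₀ → A / 2 ≤ ‖β i₀ - β i‖ := fun i hi => by
    linarith [norm_sub_norm_le (β i₀) (β i), hbd i hi]
  have hA0 : 0 ≤ A / 2 := by positivity
  have hlow : (A / 2) ^ (2 * d - 2) ≤ ∏ i, ∏ j ∈ {i}ᶜ, ‖β j - β i‖ := by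
    rw [Fintype.prod_eq_mul_prod_compl i₀, show 2 * d - 2 = (d - 1) + (d - 1) by omega, pow_add]
    have p1 : (A / 2) ^ (d - 1) ≤ ∏ j ∈ {i₀}ᶜ, ‖β j - β i₀‖ := by
      rw [← hcard i₀, ← prod_const]
      refine prod_le_prod (fun _ _ => hA0) fun j hj => ?_
      rw [norm_sub_rev]; exact hhalf j (by simpa using hj)
    have p2 : (A / 2) ^ (d - 1) ≤ ∏ i ∈ {i₀}ᶜ, ∏ j ∈ {i}ᶜ, ‖β j - β i‖ := by
      rw [← hcard i₀, ← prod_const]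
      refine prod_le_prod (fun _ _ => hA0) fun i hi => ?_
      have hi' : i ≠ i₀ := by simpa using hi
      rw [← mul_prod_erase _ _ (show i₀ ∈ ({i}ᶜ : Finset (Fin d)) by simpa using hi'.symm)]
      have : (1:ℝ) ≤ ∏ j ∈ ({i}ᶜ : Finset (Fin d)).erase i₀, ‖β j - β i‖ := by
        rw [← prod_const_one (s := ({i}ᶜ : Finset (Fin d)).erase i₀)]
        refine prod_le_prod (fun _ _ => zero_le_one) fun j hj => hsep j i ?_
        simp at hj; exact hj.2
      nlinarith [hhalf i hi']
    exact mul_le_mul p1 p2 (by positivity) (by positivity)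
  rw [hD]
  calc (∏ i, max 1 ‖β i‖) ^ (2 * d - 2) ≤ (A * C ^ (d - 1)) ^ (2 * d - 2) := by
        gcongr; 
    _ = (2 * C ^ (d - 1)) ^ (2 * d - 2) * (A / 2) ^ (2 * d - 2) := by
        rw [← mul_pow]; congr 1; ring
    _ ≤ _ := by gcongr

open NumberField in
lemma sg_bij (K : Type*) [Field K] [NumberField K] (d : ℕ) (hd : d = Module.finrank ℚ K)
    (α : 𝓞 K) (β : Fin d → ℂ)
    (hβ : (minpoly ℤ α).map (algebraMap ℤ ℂ) = ∏ i, (X - C (β i))) :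
    ∃ e : Fin d → (K →+* ℂ), Function.Bijective e ∧ ∀ i, e i (α : K) = β i := by
  classical
  have hmin : minpoly ℚ (α : K) = (minpoly ℤ α).map (algebraMap ℤ ℚ) := by
    rw [← NumberField.RingOfIntegers.minpoly_coe]
    exact minpoly.isIntegrallyClosed_eq_field_fractions' ℚ α.isIntegral_coe
  have hQ : (minpoly ℚ (α : K)).map (algebraMap ℚ ℂ) = ∏ i, (X - C (β i)) := by
    rw [hmin, Polynomial.map_map, ← hβ]
    congr 1
  have hsep : (∏ i, (X - C (β i))).Separable := by
    rw [← hQ]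
    exact (minpoly.irreducible (Algebra.IsIntegral.isIntegral (α : K))).separable.map
  have hinj : Function.Injective β := Polynomial.separable_prod_X_sub_C_iff.1 hsep
  have hex : ∀ i, ∃ φ : K →+* ℂ, φ (α : K) = β i := fun i => by
    have : β i ∈ (minpoly ℚ (α : K)).rootSet ℂ := by
      rw [Polynomial.mem_rootSet]
      refine ⟨minpoly.ne_zero (Algebra.IsIntegral.isIntegral (α : K)), ?_⟩
      rw [Polynomial.aeval_def, ← Polynomial.eval_map, hQ, Polynomial.eval_prod]
      exact prod_eq_zero (mem_univ i) (by simp)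
    rw [← NumberField.Embeddings.range_eval_eq_rootSet_minpoly] at this
    exact this
  choose e he using hex
  refine ⟨e, ?_, he⟩
  rw [Fintype.bijective_iff_injective_and_card]
  refine ⟨fun i j hij => hinj (by rw [← he, ← he, hij]), ?_⟩
  rw [NumberField.Embeddings.card, Fintype.card_fin, hd]

/-- Let `K` be a number field of degree `d ≥ 2` with at least one real embedding.
Then there exists `c_K > 0` depending only on `K` such that there are infinitely many
`α ∈ O_K` with `K = ℚ(α)`, `M(f_{α,ℤ})^(2d-2) ≤ c_K |Δ(f_{α,ℤ})|`, and all roots of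
`f_{α,ℤ}`, except one, have modulus at most `c_K`. -/
theorem small_generators_real (K : Type*) [Field K] [NumberField K]
    (d : ℕ) (hd : d = Module.finrank ℚ K) (hd2 : 2 ≤ d)
    (hreal : Nonempty (K →+* ℝ)) :
    ∃ cK : ℝ, 0 < cK ∧
      {α : NumberField.RingOfIntegers K |
        Algebra.adjoin ℚ {(α : K)} = ⊤ ∧
        ∀ β : Fin d → ℂ,
          (minpoly ℤ α).map (algebraMap ℤ ℂ) = ∏ i, (X - C (β i)) →
            (∏ i, max 1 ‖β i‖) ^ (2 * d - 2) ≤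
              cK * ‖∏ i, ∏ j ∈ univ.filter (fun j => i < j), (β i - β j) ^ 2‖ ∧
            ∃ i : Fin d, ∀ l : Fin d, l ≠ i → ‖β l‖ ≤ cK}.Infinite := by
  obtain ⟨ρ⟩ := hreal
  let φ₀ : K →+* ℂ := Complex.ofRealHom.comp ρ
  have h₀ : NumberField.ComplexEmbedding.IsReal φ₀ := by
    rw [NumberField.ComplexEmbedding.isReal_iff]
    ext x
    simp [φ₀, NumberField.ComplexEmbedding.conjugate_coe_eq]
  obtain ⟨c, hc, H⟩ := sg_values K φ₀ h₀
  refine ⟨max c ((2 * c ^ (d - 1)) ^ (2 * d - 2)), lt_max_of_lt_left (by linarith), ?_⟩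
  refine Set.Infinite.of_image (fun α : NumberField.RingOfIntegers K => ‖φ₀ (α : K)‖) ?_
  refine Set.infinite_of_not_bddAbove ?_
  rintro ⟨B, hB⟩
  obtain ⟨α, hsep, hbd, hbig⟩ := H (max (2 * c) (B + 1)) (le_max_of_le_left (by linarith))
  have hB' : ‖φ₀ (α : K)‖ ≤ B := by
    refine hB ⟨α, ⟨?_, fun β hβ => ?_⟩, rfl⟩
    · have hprim : IntermediateField.adjoin ℚ {(α : K)} = ⊤ := by
        rw [Field.primitive_element_iff_algHom_eq_of_eval' ℚ ℂ
          (fun x => IsAlgClosed.splits _)]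
        intro φ ψ hh
        by_contra hne
        have := hsep φ.toRingHom ψ.toRingHom (fun h => hne (by
          ext x; exact congrArg (fun f : K →+* ℂ => f x) h))
        have hh' : φ.toRingHom (α : K) = ψ.toRingHom (α : K) := hh
        rw [hh', sub_self, norm_zero] at this
        linarith
      rw [← IntermediateField.adjoin_simple_toSubalgebra_of_isAlgebraic
        (Algebra.IsAlgebraic.isAlgebraic (α : K)), hprim, IntermediateField.top_toSubalgebra]
    · obtain ⟨e, he, hev⟩ := sg_bij K d hd α β hβ
      obtain ⟨i₀, hi₀⟩ := he.2 φ₀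
      have hb : ∀ i, i ≠ i₀ → ‖β i‖ ≤ c := fun i hi => by
        rw [← hev]; exact hbd _ (fun h => hi (he.1 (h.trans hi₀.symm)))
      refine ⟨?_, i₀, fun l hl => (hb l hl).trans (le_max_left _ _)⟩
      refine (sg_disc β i₀ c hc (fun i j hij => ?_) hb ?_).trans ?_
      · rw [← hev, ← hev]; exact hsep _ _ (fun h => hij (he.1 h))
      · rw [← hev, hi₀]; exact (le_max_left _ _).trans hbig
      · gcongr; exact le_max_right _ _
  linarith [le_max_right (2 * c) (B + 1)]
end

section
/- Let K be a totally complex number field of degree d ≥ 2 (i.e. K has no real embeddings). Then for every α ∈ O_K with ℚ(α) = K one has M(f_{α,ℤ})^(2d−3) ≥ 2^(d(1−d)) · |Δ_K|, where Δ_K is the discriminant of K; in particular M(O_K) ≥ 2^(d(1−d)/(2d−3)) · |Δ_K|^(1/(2d−3)). -/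
open Polynomial Finset

lemma disc_bound_aux {n : ℕ} (hn : 2 ≤ n) (a : Fin n → ℂ) (c : Fin n → Fin n)
    (hc : ∀ i, c i ≠ i) (hca : ∀ i, a (c i) = star (a i)) :
    ∏ i, ∏ j ∈ {i}ᶜ, ‖a j - a i‖ ≤
      2 ^ (n * (n - 1)) * (∏ i, max 1 ‖a i‖) ^ (2 * n - 3) := by
  set m : Fin n → ℝ := fun i => max 1 ‖a i‖ with hm
  have hm1 : ∀ i, 1 ≤ m i := fun i => le_max_left _ _
  have hma : ∀ i, ‖a i‖ ≤ m i := fun i => le_max_right _ _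
  have hm0 : ∀ i, 0 < m i := fun i => lt_of_lt_of_le one_pos (hm1 i)
  set M := ∏ i, m i with hM
  have hM0 : 0 < M := Finset.prod_pos fun i _ => hm0 i
  have hmc : ∀ i, m (c i) = m i := fun i => by simp [hm, hca]
  have hrow : ∀ i, (∏ j ∈ {i}ᶜ, ‖a j - a i‖) * m i ^ 2 ≤ 2 ^ (n - 1) * m i ^ (n - 1) * M := by
    intro i
    have h1 : (∏ j ∈ {i}ᶜ, ‖a j - a i‖) * m i ≤ ∏ j ∈ {i}ᶜ, (2 * m i * m j) := by
      have hmem : c i ∈ ({i}ᶜ : Finset (Fin n)) := by simp [hc]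
      rw [← Finset.mul_prod_erase _ _ hmem, ← Finset.mul_prod_erase _ _ hmem, hmc,
        mul_right_comm]
      have hd : ∀ j, ‖a j - a i‖ ≤ m j + m i := fun j =>
        (norm_sub_le _ _).trans (add_le_add (hma j) (hma i))
      refine mul_le_mul ?_ (Finset.prod_le_prod (fun _ _ => norm_nonneg _) ?_)
        (Finset.prod_nonneg fun _ _ => norm_nonneg _) ?_
      · have := hd (c i)
        rw [hmc] at this
        nlinarith [hm0 i]
      · intro j _
        nlinarith [hd j, hm1 i, hm1 j, mul_le_mul (hm1 i) (le_refl (m j)) (hm0 j).le (hm0 i).le,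
          mul_le_mul (hm1 j) (le_refl (m i)) (hm0 i).le (hm0 j).le]
      · have := hm0 i
        positivity
    have h2 : (∏ j ∈ ({i}ᶜ : Finset (Fin n)), (2 * m i * m j)) * m i
        = 2 ^ (n - 1) * m i ^ (n - 1) * M := by
      rw [Finset.prod_mul_distrib, Finset.prod_const, Finset.card_compl, Fintype.card_fin,
        Finset.card_singleton, mul_pow, mul_assoc, hM]
      congr 1
      rw [← Finset.prod_compl_mul_prod {i} m, Finset.prod_singleton]
    calc _ = ((∏ j ∈ {i}ᶜ, ‖a j - a i‖) * m i) * m i := by ring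
      _ ≤ _ := mul_le_mul_of_nonneg_right h1 (hm0 i).le
      _ = _ := h2
  have hall := Finset.prod_le_prod (s := Finset.univ) (fun i _ => mul_nonneg
    (Finset.prod_nonneg fun _ _ => norm_nonneg _) (pow_nonneg (hm0 i).le 2)) (fun i _ => hrow i)
  rw [Finset.prod_mul_distrib, Finset.prod_mul_distrib, Finset.prod_mul_distrib,
    Finset.prod_const, Finset.prod_const, Finset.prod_pow, Finset.prod_pow, ← hM,
    Finset.card_univ, Fintype.card_fin, ← pow_mul] at hall
  refine le_of_mul_le_mul_right (hall.trans_eq ?_) (pow_pos hM0 2)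
  rw [mul_assoc, mul_assoc, ← pow_add, ← pow_add, mul_comm (n - 1)]
  congr 2
  omega

lemma discr_le_aux (K : Type*) [Field K] [NumberField K] (pb : PowerBasis ℚ K)
    (h : IsIntegral ℤ pb.gen) :
    |(NumberField.discr K : ℚ)| ≤ |Algebra.discr ℚ pb.basis| := by
  classical
  let b := (NumberField.integralBasis K).reindex
    ((NumberField.integralBasis K).indexEquiv pb.basis)
  have hb : Algebra.discr ℚ b = NumberField.discr K := by
    rw [NumberField.coe_discr, Module.Basis.coe_reindex, Algebra.discr_reindex]
  have hint : ∀ i j, IsIntegral ℤ (b.toMatrix pb.basis i j) := by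
    intro i j
    have hx : IsIntegral ℤ (pb.basis j) := by
      rw [pb.coe_basis]; exact h.pow _
    have := NumberField.integralBasis_repr_apply K ⟨_, hx⟩
      (((NumberField.integralBasis K).indexEquiv pb.basis).symm i)
    simp only [b, Module.Basis.toMatrix_apply, Module.Basis.repr_reindex,
      Finsupp.mapDomain_equiv_apply]
    erw [this]
    exact isIntegral_algebraMap
  obtain ⟨z, hz⟩ := IsIntegrallyClosed.isIntegral_iff.1
    (IsIntegral.det (M := b.toMatrix pb.basis) hint)
  have hd : Algebra.discr ℚ pb.basis = (z : ℚ) ^ 2 * NumberField.discr K := by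
    rw [← b.toMatrix_map_vecMul pb.basis, Algebra.discr_of_matrix_vecMul, hb, ← hz]
    simp
  have hne := Algebra.discr_not_zero_of_basis ℚ pb.basis
  have hz0 : z ≠ 0 := by
    rintro rfl
    exact hne (by rw [hd]; simp)
  have : (1 : ℚ) ≤ (z : ℚ) ^ 2 := by
    exact_mod_cast Int.one_le_abs (pow_ne_zero 2 hz0) |>.trans_eq (abs_of_nonneg (sq_nonneg z))
  rw [hd, abs_mul, abs_of_nonneg (sq_nonneg (z : ℚ))]
  exact le_mul_of_one_le_left (abs_nonneg _) this

lemma main_aux (K : Type*) [Field K] [NumberField K]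
    (d : ℕ) (hd : d = Module.finrank ℚ K) (hd2 : 2 ≤ d)
    (htc : ∀ σ : K →+* ℂ, ¬ NumberField.ComplexEmbedding.IsReal σ)
    (α : NumberField.RingOfIntegers K) (hgen : Algebra.adjoin ℚ {(α : K)} = ⊤) :
    |(NumberField.discr K : ℝ)| ≤ 2 ^ (d * (d - 1)) *
      (((minpoly ℤ α).aroots ℂ).map fun z => max 1 ‖z‖).prod ^ (2 * d - 3) := by
  classical
  have hαint : IsIntegral ℤ (α : K) := α.2
  let pb : PowerBasis ℚ K := PowerBasis.ofAdjoinEqTop (hαint.tower_top) hgen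
  have hpg : pb.gen = (α : K) := PowerBasis.ofAdjoinEqTop_gen _ _
  have hdim : pb.dim = d := by rw [hd, pb.finrank]
  let e : Fin pb.dim ≃ (K →ₐ[ℚ] ℂ) := Fintype.equivOfCardEq (by
    rw [Fintype.card_fin, AlgHom.card]; exact pb.finrank.symm)
  have h1 := discr_le_aux K pb (by rwa [hpg])
  have h2 : |((Algebra.discr ℚ pb.basis : ℚ) : ℝ)| =
      ∏ i, ∏ j ∈ {i}ᶜ, ‖e j pb.gen - e i pb.gen‖ := by
    have := congrArg norm (Algebra.discr_powerBasis_eq_prod'' ℚ ℂ pb e)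
    rw [Finset.prod_prod_Ioi_mul_eq_prod_prod_off_diag (fun i j => e i pb.gen - e j pb.gen)] at this
    simpa [norm_prod] using this
  have h3 := disc_bound_aux (hdim ▸ hd2) (fun i => e i pb.gen)
    (fun i => e.symm (NumberField.ComplexEmbedding.conjugate (e i : K →+* ℂ)).toRatAlgHom)
    (by
      intro i hi
      rw [Equiv.symm_apply_eq] at hi
      refine htc (e i : K →+* ℂ) (NumberField.ComplexEmbedding.isReal_iff.2 ?_)
      ext x
      exact DFunLike.congr_fun hi x)
    (by intro i; simp)
  have h4 : (((minpoly ℤ α).aroots ℂ).map fun z => max 1 ‖z‖).prod =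
      ∏ i, max 1 ‖e i pb.gen‖ := by
    have hmp : (minpoly ℤ α).aroots ℂ = (minpoly ℚ pb.gen).aroots ℂ := by
      rw [hpg, minpoly.isIntegrallyClosed_eq_field_fractions' ℚ hαint,
        NumberField.RingOfIntegers.minpoly_coe, aroots_map]
    have hnodup : ((minpoly ℚ pb.gen).aroots ℂ).Nodup :=
      nodup_roots (Separable.map (Algebra.IsSeparable.isSeparable ℚ pb.gen))
    rw [hmp]
    have : (minpoly ℚ pb.gen).aroots ℂ = (Finset.univ.val.map fun i => e i pb.gen) := by
      refine (Multiset.Nodup.ext hnodup (Multiset.Nodup.map ?_ Finset.univ.nodup)).2 ?_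
      · intro i j hij
        exact e.injective (pb.algHom_ext hij)
      · intro z
        simp only [Multiset.mem_map, Finset.mem_val, Finset.mem_univ, true_and]
        constructor
        · intro hz
          refine ⟨e.symm (pb.lift z ((mem_aroots.1 hz).2)), by simp⟩
        · rintro ⟨i, rfl⟩
          rw [mem_aroots]
          refine ⟨minpoly.ne_zero pb.isIntegral_gen, ?_⟩
          rw [aeval_algHom_apply, minpoly.aeval, map_zero]
    rw [this, Multiset.map_map]
    rfl
  rw [h4, ← hdim]
  calc |(NumberField.discr K : ℝ)| ≤ |((Algebra.discr ℚ pb.basis : ℚ) : ℝ)| := by exact_mod_cast h1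
    _ ≤ _ := h2.trans_le h3

theorem totally_complex_lower_bound (K : Type*) [Field K] [NumberField K]
    (d : ℕ) (hd : d = Module.finrank ℚ K) (hd2 : 2 ≤ d)
    (htc : ∀ σ : K →+* ℂ, ¬ NumberField.ComplexEmbedding.IsReal σ)
    (α : NumberField.RingOfIntegers K) (hgen : Algebra.adjoin ℚ {(α : K)} = ⊤) :
    ((((minpoly ℤ α).aroots ℂ).map fun z => max 1 ‖z‖).prod) ^ (2 * d - 3) ≥
      (2 : ℝ) ^ ((d : ℤ) * (1 - (d : ℤ))) * |(NumberField.discr K : ℝ)| ∧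
    (((minpoly ℤ α).aroots ℂ).map fun z => max 1 ‖z‖).prod ≥
      (2 : ℝ) ^ (((d : ℝ) * (1 - (d : ℝ))) / (2 * (d : ℝ) - 3)) *
        |(NumberField.discr K : ℝ)| ^ ((1 : ℝ) / (2 * (d : ℝ) - 3)) := by
  have hmain := main_aux K d hd hd2 htc α hgen
  set M := (((minpoly ℤ α).aroots ℂ).map fun z => max 1 ‖z‖).prod with hM
  have hM0 : 0 ≤ M := zero_le_one.trans (one_le_prod_max_one_norm_roots _)
  have hA : (2 : ℝ) ^ ((d : ℤ) * (1 - (d : ℤ))) * |(NumberField.discr K : ℝ)| ≤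
      M ^ (2 * d - 3) := by
    have he : (d : ℤ) * (1 - (d : ℤ)) = -((d * (d - 1) : ℕ) : ℤ) := by
      push_cast [Nat.cast_sub (by omega : 1 ≤ d)]; ring
    rw [he, zpow_neg, zpow_natCast, inv_mul_le_iff₀ (by positivity)]
    exact hmain
  refine ⟨hA, ?_⟩
  have hdR : (2 : ℝ) ≤ d := by exact_mod_cast hd2
  have hpos : (0 : ℝ) < 2 * (d : ℝ) - 3 := by linarith
  have hB := Real.rpow_le_rpow (by positivity) hA
    (by positivity : (0 : ℝ) ≤ 1 / (2 * (d : ℝ) - 3))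
  have hcast : ((2 * d - 3 : ℕ) : ℝ) = 2 * (d : ℝ) - 3 := by
    push_cast [Nat.cast_sub (by omega : 3 ≤ 2 * d)]; ring
  rw [Real.mul_rpow (by positivity) (abs_nonneg _), ← Real.rpow_natCast M, hcast,
    ← Real.rpow_mul hM0, mul_one_div_cancel hpos.ne', Real.rpow_one,
    ← Real.rpow_intCast, ← Real.rpow_mul (by norm_num)] at hB
  convert hB using 3
  push_cast
  ring
end

section
/- Let K be a number field of degree d ≥ 2. Then for every α ∈ O_K with ℚ(α) = K one has M(f_{α,ℤ})^(2d−2) ≥ d^(−d) · |Δ_K|, where Δ_K is the discriminant of K; in particular M(O_K) ≥ d^(−d/(2d−2)) · |Δ_K|^(1/(2d−2)). -/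
open Polynomial Finset

lemma aux_amgm (n : ℕ) (hn : 0 < n) (z : Fin n → ℝ) (hz : ∀ i, 0 ≤ z i)
    (hs : ∑ i, z i ≤ n * n) : ∏ i, z i ≤ (n : ℝ) ^ n := by
  have h := Real.geom_mean_le_arith_mean_weighted univ (fun _ => (1 / n : ℝ)) z
    (fun i _ => by positivity) (by simp; field_simp) (fun i _ => hz i)
  have hn' : (0 : ℝ) < n := by exact_mod_cast hn
  rw [← Finset.mul_sum, Real.finsetProd_rpow _ _ (fun i _ => hz i)] at h
  have h0 : 0 ≤ ∏ i, z i := prod_nonneg fun i _ => hz i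
  have h2 : (∏ i, z i) ^ (1 / n : ℝ) ≤ n := by
    refine h.trans ?_
    rw [one_div, inv_mul_le_iff₀ hn']
    exact hs
  calc ∏ i, z i = ((∏ i, z i) ^ (1 / n : ℝ)) ^ n := by
        rw [one_div, Real.rpow_inv_natCast_pow h0 hn.ne']
    _ ≤ _ := pow_le_pow_left₀ (Real.rpow_nonneg h0 _) h2 n

open scoped ComplexOrder in
lemma aux_hadamard (n : ℕ) (hn : 0 < n) (W : Matrix (Fin n) (Fin n) ℂ)
    (hW : ∀ i j, ‖W i j‖ ≤ 1) : ‖W.det‖ ^ 2 ≤ (n : ℝ) ^ n := by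
  have hP := Matrix.posSemidef_self_mul_conjTranspose W
  have hH := hP.isHermitian
  have hdet := hH.det_eq_prod_eigenvalues
  have htr := hH.trace_eq_sum_eigenvalues
  have h1 : ‖W.det‖ ^ 2 = ∏ i, hH.eigenvalues i := by
    rw [Matrix.det_mul, Matrix.det_conjTranspose, ← starRingEnd_apply, Complex.mul_conj,
      Complex.normSq_eq_norm_sq] at hdet
    exact Complex.ofReal_injective (by rw [hdet]; push_cast; rfl)
  have h2 : ∑ i, ∑ j, ‖W i j‖ ^ 2 = ∑ i, hH.eigenvalues i := by
    have : (W * W.conjTranspose).trace = ((∑ i, ∑ j, ‖W i j‖ ^ 2 : ℝ) : ℂ) := by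
      simp only [Matrix.trace, Matrix.diag, Matrix.mul_apply, Matrix.conjTranspose_apply]
      push_cast
      refine sum_congr rfl fun i _ => sum_congr rfl fun j _ => ?_
      rw [← starRingEnd_apply, Complex.mul_conj, Complex.normSq_eq_norm_sq]
      push_cast; rfl
    rw [this] at htr
    exact Complex.ofReal_injective (by rw [htr]; push_cast; rfl)
  rw [h1]
  refine aux_amgm n hn _ (fun i => hP.eigenvalues_nonneg i) ?_
  rw [← h2]
  calc ∑ i, ∑ j, ‖W i j‖ ^ 2 ≤ ∑ i : Fin n, ∑ j : Fin n, (1 : ℝ) :=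
        sum_le_sum fun i _ => sum_le_sum fun j _ => pow_le_one₀ (norm_nonneg _) (hW i j)
    _ = n * n := by simp

lemma aux_vandermonde (n : ℕ) (hn : 0 < n) (v : Fin n → ℂ) :
    ‖(Matrix.vandermonde v).det‖ ^ 2 ≤ (n : ℝ) ^ n * (∏ i, max 1 ‖v i‖) ^ (2 * n - 2) := by
  let m : Fin n → ℝ := fun i => max 1 ‖v i‖
  have hm : ∀ i, 1 ≤ m i := fun i => le_max_left _ _
  have hm0 : ∀ i, 0 < m i := fun i => one_pos.trans_le (hm i)
  let W : Matrix (Fin n) (Fin n) ℂ :=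
    Matrix.of fun i j => v i ^ (j : ℕ) / ((m i : ℂ) ^ (n - 1))
  have hV : Matrix.vandermonde v = Matrix.of fun i j => ((m i : ℂ) ^ (n - 1)) * W i j := by
    ext i j
    have : (m i : ℂ) ≠ 0 := by exact_mod_cast (hm0 i).ne'
    simp only [Matrix.vandermonde_apply, Matrix.of_apply, W]
    field_simp
  have hW : ∀ i j, ‖W i j‖ ≤ 1 := by
    intro i j
    simp only [Matrix.of_apply, W, norm_div, norm_pow, Complex.norm_real, Real.norm_eq_abs,
      abs_of_pos (hm0 i)]
    rw [div_le_one (pow_pos (hm0 i) _)]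
    calc ‖v i‖ ^ (j : ℕ) ≤ m i ^ (j : ℕ) :=
          pow_le_pow_left₀ (norm_nonneg _) (le_max_right _ _) _
      _ ≤ _ := pow_le_pow_right₀ (hm i) (by omega)
  rw [hV, Matrix.det_mul_column, norm_mul, mul_pow, mul_comm]
  have e : ‖∏ i, (m i : ℂ) ^ (n - 1)‖ ^ 2 = (∏ i, m i) ^ (2 * n - 2) := by
    rw [Finset.prod_pow, norm_pow, ← pow_mul, ← Complex.ofReal_prod, Complex.norm_real,
      Real.norm_eq_abs, abs_of_pos (prod_pos fun i _ => hm0 i)]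
    congr 1; omega
  rw [e]
  exact mul_le_mul_of_nonneg_right (aux_hadamard n hn W hW)
    (pow_nonneg (prod_nonneg fun i _ => (hm0 i).le) _)

lemma aux_index (K : Type*) [Field K] [NumberField K] (pb : PowerBasis ℚ K)
    (α : NumberField.RingOfIntegers K) (h : pb.gen = (α : K)) :
    ∃ r : ℤ, Algebra.discr ℚ pb.basis = (r : ℚ) ^ 2 * NumberField.discr K := by
  classical
  let e := (NumberField.integralBasis K).indexEquiv pb.basis
  let B := (NumberField.integralBasis K).reindex e
  let P : Matrix (Fin pb.dim) (Fin pb.dim) ℤ := Matrix.of fun i j =>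
    (NumberField.RingOfIntegers.basis K).repr (α ^ (j : ℕ)) (e.symm i)
  refine ⟨P.det, ?_⟩
  have hP : B.toMatrix pb.basis = P.map (Int.castRingHom ℚ) := by
    ext i j
    have := NumberField.integralBasis_repr_apply K (α ^ (j : ℕ)) (e.symm i)
    simp only [map_pow] at this
    simp [Module.Basis.toMatrix_apply, B, P, h, this]
  have hB : Algebra.discr ℚ B = NumberField.discr K := by
    rw [NumberField.coe_discr, Module.Basis.coe_reindex, Algebra.discr_reindex]
  rw [← hB, ← B.toMatrix_map_vecMul pb.basis, Algebra.discr_of_matrix_vecMul, hP]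
  congr 2
  exact (RingHom.map_det (Int.castRingHom ℚ) P).symm

lemma aux_roots_s10 (K : Type*) [Field K] [NumberField K] (pb : PowerBasis ℚ K)
    (α : NumberField.RingOfIntegers K) (h : pb.gen = (α : K))
    (e : Fin pb.dim ≃ (K →ₐ[ℚ] ℂ)) :
    (((minpoly ℤ α).aroots ℂ).map fun z => max 1 ‖z‖).prod = ∏ i, max 1 ‖e i pb.gen‖ := by
  classical
  have h1 : (minpoly ℤ α).aroots ℂ = (minpoly ℚ pb.gen).aroots ℂ := by
    rw [h, minpoly.isIntegrallyClosed_eq_field_fractions ℚ K α.isIntegral,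
      Polynomial.aroots_def, Polynomial.aroots_def, Polynomial.map_map,
      ← IsScalarTower.algebraMap_eq]
  have hnd : ((minpoly ℚ pb.gen).aroots ℂ).Nodup :=
    nodup_roots (.map (Algebra.IsSeparable.isSeparable ℚ pb.gen))
  rw [h1]
  have h2 : (minpoly ℚ pb.gen).aroots ℂ = (univ : Finset (Fin pb.dim)).val.map
      (fun i => e i pb.gen) := by
    refine (Multiset.Nodup.ext hnd ?_).2 ?_
    · exact Multiset.Nodup.map (fun i j hij => e.injective (pb.algHom_ext hij)) univ.nodup
    · intro z
      simp only [Multiset.mem_map, Finset.mem_val, mem_univ, true_and]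
      constructor
      · intro hz
        refine ⟨e.symm (pb.liftEquiv'.symm ⟨z, hz⟩), ?_⟩
        rw [Equiv.apply_symm_apply]
        exact congrArg Subtype.val (pb.liftEquiv'.apply_symm_apply ⟨z, hz⟩)
      · rintro ⟨i, rfl⟩
        exact (pb.liftEquiv' (e i)).2
  rw [h2, Multiset.map_map]
  rfl

/-- Let `K` be a number field of degree `d ≥ 2`. Then for every `α ∈ O_K` with
`ℚ(α) = K` one has `M(f_{α,ℤ})^(2d-2) ≥ d^(-d) |Δ_K|`; in particular
`M(O_K) ≥ d^(-d/(2d-2)) |Δ_K|^(1/(2d-2))`. -/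
theorem mahler_lower_bound_ring_of_integers (K : Type*) [Field K] [NumberField K]
    (d : ℕ) (hd : d = Module.finrank ℚ K) (hd2 : 2 ≤ d)
    (α : NumberField.RingOfIntegers K) (hgen : Algebra.adjoin ℚ {(α : K)} = ⊤) :
    ((((minpoly ℤ α).aroots ℂ).map fun z => max 1 ‖z‖).prod) ^ (2 * d - 2) ≥
      ((d : ℝ) ^ d)⁻¹ * |(NumberField.discr K : ℝ)| ∧
    (((minpoly ℤ α).aroots ℂ).map fun z => max 1 ‖z‖).prod ≥
      (d : ℝ) ^ (-(d : ℝ) / (2 * (d : ℝ) - 2)) *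
        |(NumberField.discr K : ℝ)| ^ ((1 : ℝ) / (2 * (d : ℝ) - 2)) := by
  obtain ⟨pb, hpb⟩ : ∃ pb : PowerBasis ℚ K, pb.gen = (α : K) :=
    ⟨PowerBasis.ofAdjoinEqTop (Algebra.IsIntegral.isIntegral _) hgen, by simp⟩
  have hdim : pb.dim = d := by rw [hd, pb.finrank]
  have e : Fin pb.dim ≃ (K →ₐ[ℚ] ℂ) := by
    refine (Fintype.equivFinOfCardEq ?_).symm
    rw [AlgHom.card, pb.finrank]
  rw [aux_roots_s10 K pb α hpb e]
  obtain ⟨r, hr⟩ := aux_index K pb α hpb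
  have hdisc := Algebra.discr_eq_det_embeddingsMatrixReindex_pow_two ℚ ℂ pb.basis e
  rw [Algebra.embeddingsMatrixReindex_eq_vandermonde, Matrix.det_transpose] at hdisc
  have hV := aux_vandermonde pb.dim (by omega) (fun i => e i pb.gen)
  have hr0 : r ≠ 0 := by
    rintro rfl
    exact Algebra.discr_not_zero_of_basis ℚ pb.basis (by rw [hr]; simp)
  have hle : |(NumberField.discr K : ℝ)| ≤
      ‖(Matrix.vandermonde (fun i => e i pb.gen)).det‖ ^ 2 := by
    rw [← norm_pow, ← hdisc, hr]
    have h1 : (1 : ℝ) ≤ (r : ℝ) ^ 2 := by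
      have : 0 < r ^ 2 := by positivity
      exact_mod_cast this
    simp only [map_mul, map_pow, map_intCast, norm_mul, norm_pow, Complex.norm_intCast, sq_abs]
    exact le_mul_of_one_le_left (abs_nonneg _) h1
  set M : ℝ := ∏ i, max 1 ‖e i pb.gen‖ with hM
  have hM0 : 0 ≤ M := prod_nonneg fun i _ => zero_le_one.trans (le_max_left _ _)
  have hd0 : (0 : ℝ) < d := by exact_mod_cast (by omega : 0 < d)
  have key : ((d : ℝ) ^ d)⁻¹ * |(NumberField.discr K : ℝ)| ≤ M ^ (2 * d - 2) := by
    rw [inv_mul_le_iff₀ (by positivity)]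
    have h4 := hle.trans hV
    clear_value M
    rwa [hdim] at h4
  refine ⟨key, ?_⟩
  have hc : ((2 * d - 2 : ℕ) : ℝ) = 2 * (d : ℝ) - 2 := by
    rw [Nat.cast_sub (by omega)]; push_cast; ring
  have hne : 2 * d - 2 ≠ 0 := by omega
  have h3 := Real.rpow_le_rpow (by positivity) key (z := ((2 * d - 2 : ℕ) : ℝ)⁻¹) (by positivity)
  rw [Real.pow_rpow_inv_natCast hM0 hne, Real.mul_rpow (by positivity) (by positivity), hc] at h3
  rw [ge_iff_le, one_div]
  refine le_trans (le_of_eq ?_) h3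
  congr 1
  rw [div_eq_mul_inv, Real.rpow_mul hd0.le, Real.rpow_neg hd0.le, Real.rpow_natCast]
end

section
/- Let m be a non-negative even integer, r ≥ 1 a real number, and let f ∈ ℂ[x] be a monic polynomial of degree d ≥ 2 whose roots of modulus greater than r occur in pairs of equal modulus, with all remaining roots of modulus at most r. Then |Δ(f)| ≤ (2r)^(d(d−1)) · ‖f‖₁^(2d−3), where ‖f‖₁ denotes the sum of the absolute values of the coefficients of f. -/
open Polynomial Finset

/-- If every `B i ≥ 1` is either `1` or shared with another index, the product of pairwise
maxima is bounded by `P ^ (2d-3)`. -/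
theorem prod_max_bound (d : ℕ) (hd : 2 ≤ d) (B : Fin d → ℝ) (hB : ∀ i, 1 ≤ B i)
    (hp : ∀ i, B i = 1 ∨ ∃ j, j ≠ i ∧ B j = B i) :
    ∏ i, ∏ j ∈ ({i}ᶜ : Finset (Fin d)), max (B j) (B i) ≤ (∏ i, B i) ^ (2 * d - 3) := by
  have hB0 : ∀ i, 0 < B i := fun i => lt_of_lt_of_le one_pos (hB i)
  have hmax : ∀ i j, max (B j) (B i) ≤ B j * B i := fun i j =>
    max_le (le_mul_of_one_le_right (hB0 j).le (hB i)) (le_mul_of_one_le_left (hB0 i).le (hB j))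
  set P := ∏ i, B i with hP
  have hP0 : 0 < P := Finset.prod_pos fun i _ => hB0 i
  have hsplit : ∀ i, P = B i * ∏ j ∈ ({i}ᶜ : Finset (Fin d)), B j := fun i =>
    (Fintype.prod_eq_mul_prod_compl i B)
  have hcard : ∀ i : Fin d, ({i}ᶜ : Finset (Fin d)).card = d - 1 := fun i => by
    simp [Finset.card_compl]
  have key : ∀ i, B i ^ 2 * ∏ j ∈ ({i}ᶜ : Finset (Fin d)), max (B j) (B i)
      ≤ B i ^ (d - 1) * P := by
    intro i
    rcases hp i with h1 | ⟨k, hk, hkB⟩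
    · rw [hsplit i, h1]
      simp only [one_pow, one_mul]
      apply Finset.prod_le_prod
      · intro j _; positivity
      · intro j _; simpa using hB j
    · have hmem : k ∈ ({i}ᶜ : Finset (Fin d)) := by simpa using hk
      have e1 : ∏ j ∈ ({i}ᶜ : Finset (Fin d)), B j * B i
          = (∏ j ∈ ({i}ᶜ : Finset (Fin d)), B j) * B i ^ (d - 1) := by
        rw [Finset.prod_mul_distrib, Finset.prod_const, hcard]
      have e2 : B i * ∏ j ∈ ({i}ᶜ : Finset (Fin d)), max (B j) (B i)
          ≤ ∏ j ∈ ({i}ᶜ : Finset (Fin d)), B j * B i := by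
        rw [← Finset.mul_prod_erase _ _ hmem, ← Finset.mul_prod_erase _ (fun j => B j * B i) hmem]
        have e3 : ∏ j ∈ ({i}ᶜ : Finset (Fin d)).erase k, max (B j) (B i)
            ≤ ∏ j ∈ ({i}ᶜ : Finset (Fin d)).erase k, B j * B i :=
          Finset.prod_le_prod (fun j _ => (hB0 j).le.trans (le_max_left _ _))
            (fun j _ => hmax i j)
        rw [hkB, max_self, ← mul_assoc]
        exact mul_le_mul_of_nonneg_left e3 (mul_pos (hB0 i) (hB0 i)).le
      calc _ = B i * (B i * ∏ j ∈ ({i}ᶜ : Finset (Fin d)), max (B j) (B i)) := by ring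
        _ ≤ B i * ∏ j ∈ ({i}ᶜ : Finset (Fin d)), B j * B i :=
          mul_le_mul_of_nonneg_left e2 (hB0 i).le
        _ = _ := by rw [e1, hsplit i]; ring
  have tot := Finset.prod_le_prod (s := (univ : Finset (Fin d)))
    (fun i _ => mul_nonneg (pow_pos (hB0 i) 2).le
      (Finset.prod_nonneg fun j _ => (hB0 j).le.trans (le_max_left _ _))) (fun i _ => key i)
  rw [Finset.prod_mul_distrib, Finset.prod_mul_distrib, Finset.prod_pow, Finset.prod_pow,
    Finset.prod_const, Finset.card_univ, Fintype.card_fin, ← hP, ← pow_add] at tot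
  have e : d - 1 + d = 2 + (2 * d - 3) := by omega
  rw [e, pow_add] at tot
  exact le_of_mul_le_mul_left tot (by positivity)

/-- **Corollary.** Let `m` be non-negative and even, `r ≥ 1`, and let `f ∈ ℂ[x]` be a
monic polynomial of degree `d ≥ 2` whose roots of modulus greater than `r` occur in
pairs of equal modulus, with all remaining roots of modulus at most `r`. Then
`|Δ(f)| ≤ (2r)^(d(d-1)) ‖f‖₁^(2d-3)`, where `‖f‖₁` is the sum of the absolute values
of the coefficients of `f`.

Here the roots are listed as `α 0, …, α (d-1)` with the first `m` of them being
`m/2` equal-modulus pairs `(α (2k), α (2k+1))`, and all roots `α i` with `i ≥ m`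
having modulus at most `r`. -/
theorem discriminant_L1_bound_paired (d m : ℕ) (hd : 2 ≤ d) (hm : Even m) (hmd : m ≤ d)
    (r : ℝ) (hr : 1 ≤ r) (α : Fin d → ℂ) (f : Polynomial ℂ)
    (hf : f = ∏ i, (X - C (α i)))
    (hpair : ∀ k : ℕ, ∀ hk : 2 * k + 1 < m,
      ‖α ⟨2 * k, by omega⟩‖ = ‖α ⟨2 * k + 1, by omega⟩‖)
    (hsmall : ∀ i : Fin d, m ≤ (i : ℕ) → ‖α i‖ ≤ r) :
    ‖∏ i, ∏ j ∈ univ.filter (fun j => i < j), (α i - α j) ^ 2‖ ≤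
      (2 * r) ^ (d * (d - 1)) * (∑ i ∈ Finset.range (d + 1), ‖f.coeff i‖) ^ (2 * d - 3) := by
  have hr0 : 0 < r := lt_of_lt_of_le one_pos hr
  set S := ∑ i ∈ Finset.range (d + 1), ‖f.coeff i‖ with hS
  set B : Fin d → ℝ := fun i => max r ‖α i‖ / r with hBdef
  have hB : ∀ i, 1 ≤ B i := fun i => by
    rw [hBdef]; simp only; rw [le_div_iff₀ hr0, one_mul]; exact le_max_left _ _
  have hBA : ∀ i, B i ≤ max 1 ‖α i‖ := fun i => by
    rw [hBdef]; simp only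
    rw [div_le_iff₀ hr0]
    apply max_le
    · exact le_mul_of_one_le_left hr0.le (le_max_left _ _)
    · exact (le_max_right _ _).trans (le_mul_of_one_le_right (by positivity) hr)
  have hp : ∀ i, B i = 1 ∨ ∃ j, j ≠ i ∧ B j = B i := by
    intro i
    by_cases hi : m ≤ (i : ℕ)
    · left
      rw [hBdef]; simp only
      rw [max_eq_left (hsmall i hi), div_self hr0.ne']
    · right
      push Not at hi
      obtain ⟨i, hid⟩ := i
      simp only at hi
      obtain ⟨n, hn⟩ := hm
      rcases Nat.even_or_odd' i with ⟨k, rfl | rfl⟩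
      · refine ⟨⟨2 * k + 1, by omega⟩, by simp, ?_⟩
        simp only [hBdef]
        rw [hpair k (by omega)]
      · refine ⟨⟨2 * k, by omega⟩, by simp, ?_⟩
        simp only [hBdef]
        rw [hpair k (by omega)]
  have hPS : ∏ i, B i ≤ S := by
    have h1 : ∏ i, B i ≤ ∏ i, max 1 ‖α i‖ :=
      Finset.prod_le_prod (fun i _ => zero_le_one.trans (hB i)) (fun i _ => hBA i)
    have hdeg : f.natDegree = d := by
      rw [hf, Polynomial.natDegree_prod_of_monic _ _ (fun i _ => monic_X_sub_C _)]; simp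
    have h2 : f.mahlerMeasure = ∏ i, max 1 ‖α i‖ := by
      rw [hf, Finset.prod_eq_multiset_prod, prod_mahlerMeasure_eq_mahlerMeasure_prod,
        Multiset.map_map]
      simp [Finset.prod_eq_multiset_prod]
    have h3 : f.mahlerMeasure ≤ S := by
      refine (mahlerMeasure_le_sum_norm_coeff f).trans_eq ?_
      rw [Polynomial.sum_over_range f (fun _ => norm_zero), hdeg]
    linarith
  have hbase : ∀ i j, ‖α i - α j‖ ≤ (2 * r) * max (B i) (B j) := by
    intro i j
    have hi : ‖α i‖ ≤ r * B i := by
      simp only [hBdef]; rw [mul_div_cancel₀ _ hr0.ne']; exact le_max_right _ _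
    have hj : ‖α j‖ ≤ r * B j := by
      simp only [hBdef]; rw [mul_div_cancel₀ _ hr0.ne']; exact le_max_right _ _
    have := norm_sub_le (α i) (α j)
    have a := mul_le_mul_of_nonneg_left (le_max_left (B i) (B j)) hr0.le
    have b := mul_le_mul_of_nonneg_left (le_max_right (B i) (B j)) hr0.le
    linarith
  have hre : ‖∏ i, ∏ j ∈ univ.filter (fun j => i < j), (α i - α j) ^ 2‖
      = ∏ i, ∏ j ∈ ({i}ᶜ : Finset (Fin d)), ‖α j - α i‖ := by
    rw [← Finset.prod_prod_Ioi_mul_eq_prod_prod_off_diag (fun j i => ‖α j - α i‖)]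
    rw [norm_prod]
    refine Finset.prod_congr rfl fun i _ => ?_
    rw [norm_prod]
    refine Finset.prod_congr (by ext; simp) fun j _ => ?_
    rw [norm_pow, sq, norm_sub_rev (α j)]
  rw [hre]
  calc ∏ i, ∏ j ∈ ({i}ᶜ : Finset (Fin d)), ‖α j - α i‖
      ≤ ∏ i, ∏ j ∈ ({i}ᶜ : Finset (Fin d)), (2 * r) * max (B j) (B i) :=
        Finset.prod_le_prod (fun i _ => Finset.prod_nonneg fun j _ => norm_nonneg _)
          (fun i _ => Finset.prod_le_prod (fun j _ => norm_nonneg _) (fun j _ => hbase j i))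
    _ = (2 * r) ^ (d * (d - 1)) * ∏ i, ∏ j ∈ ({i}ᶜ : Finset (Fin d)), max (B j) (B i) := by
        simp only [Finset.prod_mul_distrib, Finset.prod_const, Finset.card_compl,
          Finset.card_singleton, Fintype.card_fin, Finset.card_univ]
        rw [mul_pow 2 r, mul_comm d (d - 1), pow_mul, pow_mul]
    _ ≤ (2 * r) ^ (d * (d - 1)) * S ^ (2 * d - 3) := by
        refine mul_le_mul_of_nonneg_left ?_ (by positivity)
        exact (prod_max_bound d hd B hB hp).trans
          (pow_le_pow_left₀ (Finset.prod_nonneg fun i _ => zero_le_one.trans (hB i)) hPS _)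
end

section
/- Let f ∈ ℂ[x] be a polynomial of degree d ≥ 2. Then |Δ(f)| ≤ d^d · ‖f‖₁^(2d−2), where ‖f‖₁ denotes the sum of the absolute values of the coefficients of f. -/
open Polynomial Finset

/-- AM-GM in power form. -/
lemma prod_le_pow_amgm (d : ℕ) (hd : 0 < d) (x : Fin d → ℝ) (hx : ∀ i, 0 ≤ x i)
    (hs : ∑ i, x i ≤ (d : ℝ) * d) : ∏ i, x i ≤ (d : ℝ) ^ d := by
  have hd' : (0 : ℝ) < d := by exact_mod_cast hd
  have h := Real.geom_mean_le_arith_mean (s := univ) (fun _ : Fin d => (1 : ℝ)) x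
    (by simp) (by simpa using hd) (fun i _ => hx i)
  simp only [Real.rpow_one, one_mul, sum_const, card_univ, Fintype.card_fin, nsmul_eq_mul,
    mul_one] at h
  have h0 : 0 ≤ ∏ i, x i := prod_nonneg fun i _ => hx i
  have h1 : (∏ i, x i) ^ ((d : ℝ)⁻¹) ≤ d := h.trans (by rw [div_le_iff₀ hd']; exact hs)
  calc ∏ i, x i = ((∏ i, x i) ^ ((d : ℝ)⁻¹)) ^ d := by
        rw [Real.rpow_inv_natCast_pow h0 hd.ne']
    _ ≤ (d : ℝ) ^ d := by gcongr

open scoped ComplexOrder in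
/-- Hadamard's bound for matrices with entries of norm at most one. -/
lemma hadamard_unit (d : ℕ) (hd : 0 < d) (A : Matrix (Fin d) (Fin d) ℂ)
    (hA : ∀ i j, ‖A i j‖ ≤ 1) : ‖A.det‖ ^ 2 ≤ (d : ℝ) ^ d := by
  have hP : (A * A.conjTranspose).PosSemidef := Matrix.posSemidef_self_mul_conjTranspose A
  have hdet := hP.isHermitian.det_eq_prod_eigenvalues
  have htr := hP.isHermitian.trace_eq_sum_eigenvalues
  have h := prod_le_pow_amgm d hd hP.isHermitian.eigenvalues hP.eigenvalues_nonneg ?_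
  · refine le_trans (le_of_eq ?_) h
    rw [Matrix.det_mul, Matrix.det_conjTranspose] at hdet
    have h2 : ((‖A.det‖ ^ 2 : ℝ) : ℂ) = ((∏ i, hP.isHermitian.eigenvalues i : ℝ) : ℂ) := by
      push_cast
      rw [← Complex.mul_conj']
      exact hdet
    exact_mod_cast h2
  · have h2 : ((∑ i, ∑ j, ‖A i j‖ ^ 2 : ℝ) : ℂ)
        = ((∑ i, hP.isHermitian.eigenvalues i : ℝ) : ℂ) := by
      push_cast
      refine Eq.trans ?_ htr
      simp only [Matrix.trace, Matrix.diag_apply, Matrix.mul_apply, Matrix.conjTranspose_apply]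
      refine sum_congr rfl fun i _ => sum_congr rfl fun j _ => ?_
      rw [← Complex.mul_conj']
      rfl
    have h3 := Complex.ofReal_injective h2
    rw [← h3]
    calc ∑ i, ∑ j, ‖A i j‖ ^ 2 ≤ ∑ i : Fin d, ∑ j : Fin d, (1 : ℝ) := by
          refine sum_le_sum fun i _ => sum_le_sum fun j _ => ?_
          exact pow_le_one₀ (norm_nonneg _) (hA i j)
      _ = (d : ℝ) * d := by simp


/-- **Mahler (1964), Corollary.** For `f ∈ ℂ[x]` of degree `d ≥ 2`,
`|Δ(f)| ≤ d^d ‖f‖₁^(2d-2)`, where `‖f‖₁` is the sum of the absolute values of the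
coefficients of `f`. -/
theorem discriminant_L1_bound (d : ℕ) (hd : 2 ≤ d) (f : Polynomial ℂ) (a₀ : ℂ)
    (ha₀ : a₀ ≠ 0) (α : Fin d → ℂ) (hf : f = C a₀ * ∏ i, (X - C (α i))) :
    ‖a₀ ^ (2 * d - 2) * ∏ i, ∏ j ∈ univ.filter (fun j => i < j), (α i - α j) ^ 2‖ ≤
      (d : ℝ) ^ d * (∑ i ∈ Finset.range (d + 1), ‖f.coeff i‖) ^ (2 * d - 2) := by

  have hd0 : 0 < d := by omega
  set m : Fin d → ℝ := fun i => max 1 ‖α i‖ with hm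
  have hm1 : ∀ i, 1 ≤ m i := fun i => le_max_left _ _
  have hm0 : ∀ i, 0 < m i := fun i => lt_of_lt_of_le one_pos (hm1 i)
  -- Hadamard bound for the scaled Vandermonde matrix
  have hH := hadamard_unit d hd0
    (Matrix.diagonal (fun i => (((m i ^ (d - 1))⁻¹ : ℝ) : ℂ)) * Matrix.vandermonde α) (by
      intro i j
      rw [Matrix.diagonal_mul, Matrix.vandermonde_apply, norm_mul, norm_pow, Complex.norm_real,
        Real.norm_of_nonneg (inv_nonneg.2 (pow_nonneg (hm0 i).le _)),
        inv_mul_le_iff₀ (pow_pos (hm0 i) _), mul_one]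
      calc ‖α i‖ ^ (j : ℕ) ≤ m i ^ (j : ℕ) := by
            gcongr
            exact le_max_right _ _
        _ ≤ m i ^ (d - 1) := pow_le_pow_right₀ (hm1 i) (by omega))
  rw [Matrix.det_mul, Matrix.det_diagonal, norm_mul, norm_prod] at hH
  have hc : ∏ i, ‖(((m i ^ (d - 1))⁻¹ : ℝ) : ℂ)‖ = ((∏ i, m i) ^ (d - 1))⁻¹ := by
    rw [← prod_pow, ← prod_inv_distrib]
    refine prod_congr rfl fun i _ => ?_
    rw [Complex.norm_real, Real.norm_of_nonneg (inv_nonneg.2 (pow_nonneg (hm0 i).le _))]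
  have hMpos : 0 < ∏ i, m i := prod_pos fun i _ => hm0 i
  rw [hc, mul_pow, inv_pow, inv_mul_le_iff₀ (by positivity), ← pow_mul] at hH
  have he : (d - 1) * 2 = 2 * d - 2 := by omega
  rw [he] at hH
  -- the discriminant is the squared Vandermonde determinant
  have hV : ‖∏ i, ∏ j ∈ univ.filter (fun j => i < j), (α i - α j) ^ 2‖
      = ‖(Matrix.vandermonde α).det‖ ^ 2 := by
    rw [Matrix.det_vandermonde, ← norm_pow, ← prod_pow]
    congr 1
    refine prod_congr rfl fun i _ => ?_
    rw [← prod_pow]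
    refine prod_congr (by ext j; simp) fun j _ => by ring
  -- Mahler measure
  have hM : ‖a₀‖ * ∏ i, m i ≤ ∑ i ∈ Finset.range (d + 1), ‖f.coeff i‖ := by
    have h1 : f.mahlerMeasure = ‖a₀‖ * ∏ i, m i := by
      rw [hf, mahlerMeasure_mul, mahlerMeasure_const]
      congr 1
      have := prod_mahlerMeasure_eq_mahlerMeasure_prod
        (univ.val.map fun i => (X - C (α i) : ℂ[X]))
      rw [Multiset.map_map] at this
      refine this.trans ?_
      exact prod_congr rfl fun i _ => mahlerMeasure_X_sub_C _
    rw [← h1]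
    refine (mahlerMeasure_le_sum_norm_coeff f).trans (le_of_eq ?_)
    refine sum_over_range' f (by simp) (d + 1) ?_
    rw [hf, natDegree_C_mul ha₀, natDegree_prod_of_monic _ _ fun i _ => monic_X_sub_C _]
    simp
  rw [norm_mul, norm_pow, hV]
  calc ‖a₀‖ ^ (2 * d - 2) * ‖(Matrix.vandermonde α).det‖ ^ 2
      ≤ ‖a₀‖ ^ (2 * d - 2) * ((∏ i, m i) ^ (2 * d - 2) * (d : ℝ) ^ d) := by gcongr
    _ = (d : ℝ) ^ d * (‖a₀‖ * ∏ i, m i) ^ (2 * d - 2) := by rw [mul_pow]; ring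
    _ ≤ _ := by gcongr
end

section
/- Let k ≥ 2 and d ≥ 2 be integers and fix r ≥ 1. For every real C > 0 and every real e < 2d−3, there exists a tuple α = (a₁,…,a_d) of points in ℝ^k in which exactly two points have Euclidean norm greater than r and these two points have equal Euclidean norm (all other points having norm at most r), such that M(α)^e < C · |Δ(α)|. In other words, the exponent 2d−3 in the inequality M(α)^(2d−3) ≥ (2r)^(d(1−d)) · |Δ(α)| is sharp. -/
open Finset

/-- Positions on a line: `t`, `-t`, and `n` equally spaced points in `[0,1)`. -/
noncomputable def sharpPos (n : ℕ) (t : ℝ) : Fin (n + 2) → ℝ :=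
  Fin.cons t (Fin.cons (-t) (fun l : Fin n => (l : ℝ) / ((n : ℝ) + 2)))

/-- Row-wise lower bounds for the distances. -/
noncomputable def sharpLow (n : ℕ) (t : ℝ) : Fin (n + 2) → ℝ :=
  Fin.cons (t / 2) (Fin.cons (t / 2) (fun _ : Fin n => 1 / ((n : ℝ) + 2)))

lemma sharpPos_bound (n : ℕ) (l : Fin n) :
    0 ≤ (l : ℝ) / ((n : ℝ) + 2) ∧ (l : ℝ) / ((n : ℝ) + 2) ≤ 1 := by
  have h : (l : ℝ) < n := by exact_mod_cast l.2
  refine ⟨by positivity, ?_⟩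
  rw [div_le_one (by positivity)]
  linarith

lemma sharpLow_nonneg (n : ℕ) (t : ℝ) (ht : 2 ≤ t) (i : Fin (n + 2)) : 0 ≤ sharpLow n t i := by
  refine Fin.cases ?_ (fun i => Fin.cases ?_ (fun i => ?_) i) i
  · simp [sharpLow]; linarith
  · simp [sharpLow]; linarith
  · simp [sharpLow]; positivity

lemma sharpLow_le (n : ℕ) (t : ℝ) (ht : 2 ≤ t) (i j : Fin (n + 2)) (hij : i < j) :
    sharpLow n t i ≤ |sharpPos n t i - sharpPos n t j| := by
  revert hij
  refine Fin.cases ?_ (fun i => Fin.cases ?_ (fun i => ?_) i) i <;>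
  refine Fin.cases ?_ (fun j => Fin.cases ?_ (fun j => ?_) j) j <;> intro hij
  · simp at hij
  · simp only [sharpLow, sharpPos, Fin.cons_zero, Fin.cons_succ]
    refine le_trans ?_ (le_abs_self _); linarith
  · simp only [sharpLow, sharpPos, Fin.cons_zero, Fin.cons_succ]
    have := sharpPos_bound n j
    refine le_trans ?_ (le_abs_self _); linarith
  · simp at hij
  · simp at hij
  · simp only [sharpLow, sharpPos, Fin.cons_zero, Fin.cons_succ]
    have := sharpPos_bound n j
    refine le_trans ?_ (neg_le_abs _); linarith
  · simp at hij
  · simp [Fin.lt_def] at hij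
  · simp only [sharpLow, sharpPos, Fin.cons_succ]
    have h : (i : ℝ) + 1 ≤ j := by
      have : i < j := by simpa using hij
      exact_mod_cast this
    refine le_trans ?_ (neg_le_abs _)
    rw [← sub_div, ← neg_div]
    gcongr
    linarith

theorem energy_exponent_sharp (k d : ℕ) (hk : 2 ≤ k) (hd : 2 ≤ d) (r : ℝ) (hr : 1 ≤ r)
    (C : ℝ) (hC : 0 < C) (e : ℝ) (he : e < 2 * (d : ℝ) - 3) :
    ∃ a : Fin d → EuclideanSpace ℝ (Fin k),
      (∃ i j : Fin d, i ≠ j ∧ r < ‖a i‖ ∧ ‖a i‖ = ‖a j‖ ∧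
        ∀ l : Fin d, l ≠ i → l ≠ j → ‖a l‖ ≤ r) ∧
      (∏ i, max 1 ‖a i‖) ^ e <
        C * ∏ i, ∏ j ∈ univ.filter (fun j => i < j), ‖a i - a j‖ ^ 2 := by
  obtain ⟨n, rfl⟩ : ∃ n, d = n + 2 := ⟨d - 2, by omega⟩
  have he' : 0 < 4 * (n : ℝ) + 2 - 2 * e := by push_cast at he; linarith
  set K : ℝ := ∏ i : Fin n, ((1 / ((n : ℝ) + 2)) ^ 2) ^
    (univ.filter (fun j : Fin (n + 2) => i.succ.succ < j)).card with hK
  have hKpos : 0 < K := Finset.prod_pos (fun i _ => by positivity)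
  obtain ⟨t, ht2, htr, ht⟩ : ∃ t : ℝ, 2 ≤ t ∧ r < t ∧
      2 ^ (4 * n + 2) / (C * K) < t ^ (4 * (n : ℝ) + 2 - 2 * e) :=
    ((Filter.eventually_ge_atTop 2).and ((Filter.eventually_gt_atTop r).and
      ((tendsto_rpow_atTop he').eventually_gt_atTop _))).exists
  have ht0 : 0 < t := by linarith
  let u : EuclideanSpace ℝ (Fin k) := EuclideanSpace.single ⟨0, by omega⟩ 1
  have hu : ‖u‖ = 1 := by simp [u]
  have hn : ∀ x : ℝ, ‖x • u‖ = |x| := fun x => by rw [norm_smul, hu, mul_one, Real.norm_eq_abs]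
  have hs : ∀ l : Fin n, |sharpPos n t l.succ.succ| ≤ 1 := fun l => by
    have := sharpPos_bound n l
    simp only [sharpPos, Fin.cons_succ]
    rw [abs_of_nonneg this.1]; exact this.2
  have hs0 : |sharpPos n t 0| = t := by simp [sharpPos, abs_of_pos ht0]
  have hs1 : |sharpPos n t (Fin.succ 0)| = t := by
    simp only [sharpPos, Fin.cons_succ, Fin.cons_zero, abs_neg, abs_of_pos ht0]
  refine ⟨fun i => sharpPos n t i • u, ⟨0, Fin.succ 0, (Fin.succ_ne_zero _).symm, ?_, ?_, ?_⟩, ?_⟩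
  · simp only [hn, hs0, htr]
  · simp only [hn, hs0, hs1]
  · intro l
    refine Fin.cases ?_ (fun l => Fin.cases ?_ (fun l => ?_) l) l
    · intro h; exact absurd rfl h
    · intro _ h; exact absurd rfl h
    · intro _ _
      simp only [hn]
      exact (hs l).trans hr
  · simp only [← sub_smul, hn]
    have hM : ∏ i, max 1 |sharpPos n t i| = t ^ (2 : ℝ) := by
      rw [Fin.prod_univ_succ, Fin.prod_univ_succ, hs0, hs1,
        Finset.prod_eq_one (fun l _ => max_eq_left (hs l)), max_eq_right (by linarith)]
      rw [Real.rpow_two]; ring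
    have hD : ∏ i, ∏ j ∈ univ.filter (fun j => i < j), (sharpLow n t i) ^ 2 ≤
        ∏ i, ∏ j ∈ univ.filter (fun j => i < j), |sharpPos n t i - sharpPos n t j| ^ 2 := by
      refine Finset.prod_le_prod (fun i _ => Finset.prod_nonneg fun j _ => sq_nonneg _)
        (fun i _ => Finset.prod_le_prod (fun j _ => sq_nonneg _) (fun j hj => ?_))
      exact pow_le_pow_left₀ (sharpLow_nonneg n t ht2 i)
        (sharpLow_le n t ht2 i j (by simpa using hj)) 2
    have hL : ∏ i, ∏ j ∈ univ.filter (fun j => i < j), (sharpLow n t i) ^ 2 =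
        (t / 2) ^ (4 * n + 2) * K := by
      have c0 : (univ.filter (fun j : Fin (n + 2) => 0 < j)).card = n + 1 := by
        rw [Finset.filter_lt_eq_Ioi, Fin.card_Ioi]; simp
      have c1 : (univ.filter (fun j : Fin (n + 2) => Fin.succ 0 < j)).card = n := by
        rw [Finset.filter_lt_eq_Ioi, Fin.card_Ioi]; simp
      simp only [Finset.prod_const]
      rw [Fin.prod_univ_succ, Fin.prod_univ_succ, c0, c1, hK]
      simp only [sharpLow, Fin.cons_succ, Fin.cons_zero]
      rw [← mul_assoc]
      congr 1
      generalize t / 2 = x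
      ring
    rw [hM, ← Real.rpow_mul ht0.le]
    rw [hL] at hD
    refine lt_of_lt_of_le ?_ (mul_le_mul_of_nonneg_left hD hC.le)
    rw [Real.rpow_sub ht0, div_lt_div_iff₀ (by positivity) (by positivity)] at ht
    have h4 : t ^ (4 * (n : ℝ) + 2) = t ^ (4 * n + 2) := by
      rw [← Real.rpow_natCast]; push_cast; rfl
    rw [h4] at ht
    rw [div_pow]
    have : C * (t ^ (4 * n + 2) / 2 ^ (4 * n + 2) * K) =
      (t ^ (4 * n + 2) * (C * K)) / 2 ^ (4 * n + 2) := by ring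
    rw [this, lt_div_iff₀ (by positivity)]
    linarith
end

section
/- Let K be a number field of degree d with at least one non-real embedding. There exists a constant c_K > 0, depending only on K, such that there are infinitely many α ∈ O_K with K = ℚ(α) and ‖f_{α,ℤ}‖₁^(2d−3) ≤ c_K · |Δ(f_{α,ℤ})|, where ‖f‖₁ denotes the sum of the absolute values of the coefficients of f. -/
open Polynomial Finset

/-- The sum of the norms of the coefficients of a product of linear factors. -/
theorem aux_L1_le {ι : Type*} (s : Finset ι) (β : ι → ℂ) (n : ℕ) :
    ∑ i ∈ Finset.range n, ‖(∏ i ∈ s, (X - C (β i))).coeff i‖ ≤ ∏ i ∈ s, (1 + ‖β i‖) := by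
  classical
  induction s using Finset.induction_on with
  | empty =>
    simp only [Finset.prod_empty, coeff_one]
    calc ∑ x ∈ Finset.range n, ‖(if x = 0 then (1 : ℂ) else 0)‖
        = ∑ x ∈ Finset.range n, (if x = 0 then (1 : ℝ) else 0) := by
          refine Finset.sum_congr rfl fun x _ => ?_
          split_ifs <;> simp
      _ ≤ 1 := by
          rw [Finset.sum_ite_eq']
          split_ifs <;> simp
  | insert a s ha ih =>
    rw [Finset.prod_insert ha, Finset.prod_insert ha]
    set q := ∏ i ∈ s, (X - C (β i)) with hq
    have h1 : ∑ i ∈ Finset.range n, ‖(X * q).coeff i‖ ≤ ∑ i ∈ Finset.range n, ‖q.coeff i‖ := by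
      cases n with
      | zero => simp
      | succ m =>
        rw [Finset.sum_range_succ']
        simp only [coeff_X_mul, coeff_X_mul_zero, norm_zero, add_zero]
        exact Finset.sum_le_sum_of_subset_of_nonneg
          (Finset.range_mono (Nat.le_succ m)) (fun _ _ _ => norm_nonneg _)
    have h2 : ∀ i, ‖((X - C (β a)) * q).coeff i‖ ≤ ‖(X * q).coeff i‖ + ‖β a‖ * ‖q.coeff i‖ := by
      intro i
      rw [sub_mul, coeff_sub, coeff_C_mul, ← norm_mul]
      exact norm_sub_le _ _
    calc _ ≤ ∑ i ∈ Finset.range n, (‖(X * q).coeff i‖ + ‖β a‖ * ‖q.coeff i‖) :=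
          Finset.sum_le_sum fun i _ => h2 i
      _ = ∑ i ∈ Finset.range n, ‖(X * q).coeff i‖
            + ‖β a‖ * ∑ i ∈ Finset.range n, ‖q.coeff i‖ := by
          rw [Finset.sum_add_distrib, Finset.mul_sum]
      _ ≤ (1 + ‖β a‖) * ∑ i ∈ Finset.range n, ‖q.coeff i‖ := by linarith
      _ ≤ _ := mul_le_mul_of_nonneg_left ih (by positivity)

theorem aux_prod_weight {ι : Type*} [Fintype ι] [DecidableEq ι] (S A : Finset ι) (h : S ⊆ A)
    (T : ℝ) : ∏ i ∈ A, (if i ∈ S then T else 1) = T ^ S.card := by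
  rw [Finset.prod_ite_mem, Finset.inter_eq_right.mpr h, Finset.prod_const]

theorem aux_disc_lower {ι : Type*} [Fintype ι] [DecidableEq ι] (z : ι → ℂ) (S : Finset ι)
    (hS : S.card = 2) (T : ℝ) (hT : 1 ≤ T)
    (h1 : ∀ i j, i ≠ j → 1 ≤ ‖z i - z j‖)
    (h2 : ∀ i j, i ≠ j → i ∈ S → T ≤ ‖z i - z j‖) :
    (T ^ 2) ^ (2 * Fintype.card ι - 3) ≤ ∏ i, ∏ j ∈ {i}ᶜ, ‖z j - z i‖ := by
  have hd : 2 ≤ Fintype.card ι := hS ▸ Finset.card_le_univ S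
  have key : ∀ i, (if i ∈ S then T ^ (Fintype.card ι - 1) else T ^ 2)
      ≤ ∏ j ∈ {i}ᶜ, ‖z j - z i‖ := by
    intro i
    split_ifs with hi
    · calc T ^ (Fintype.card ι - 1) = ∏ j ∈ ({i}ᶜ : Finset ι), T := by
            rw [Finset.prod_const, Finset.card_compl, Finset.card_singleton]
        _ ≤ _ := by
            refine Finset.prod_le_prod (fun _ _ => by linarith) fun j hj => ?_
            rw [norm_sub_rev]
            exact h2 i j (by simpa [eq_comm] using hj) hi
    · rw [← hS, ← aux_prod_weight S {i}ᶜ (by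
        intro j hj; simp only [mem_compl, mem_singleton]; rintro rfl; exact hi hj) T]
      refine Finset.prod_le_prod (fun _ _ => by split_ifs <;> linarith) fun j hj => ?_
      have hji : j ≠ i := by simpa using hj
      split_ifs with hjS
      · exact h2 j i hji hjS
      · exact h1 j i hji
  calc (T ^ 2) ^ (2 * Fintype.card ι - 3)
      = ∏ i, (if i ∈ S then T ^ (Fintype.card ι - 1) else T ^ 2) := by
        rw [Finset.prod_ite, Finset.prod_const, Finset.prod_const, Finset.filter_mem_eq_inter,
          Finset.univ_inter, hS, Finset.filter_notMem_eq_sdiff, ← Finset.compl_eq_univ_sdiff,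
          Finset.card_compl, hS, ← pow_mul, ← pow_mul, ← pow_mul, ← pow_add]
        congr 1
        omega
    _ ≤ _ := Finset.prod_le_prod (fun _ _ => by split_ifs <;> positivity) fun i _ => key i

theorem aux_upper {ι : Type*} [Fintype ι] [DecidableEq ι] (z : ι → ℂ) (S : Finset ι)
    (hS : S.card = 2) (T D : ℝ) (hT : 1 ≤ T) (hD : 1 ≤ D)
    (h1 : ∀ i, i ∉ S → ‖z i‖ ≤ D) (h2 : ∀ i, i ∈ S → ‖z i‖ ≤ D * T) :
    ∏ i, (1 + ‖z i‖) ≤ (2 * D) ^ Fintype.card ι * T ^ 2 := by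
  calc ∏ i, (1 + ‖z i‖) ≤ ∏ i, ((2 * D) * (if i ∈ S then T else 1)) := by
        refine Finset.prod_le_prod (fun _ _ => by positivity) fun i _ => ?_
        split_ifs with hi
        · have := h2 i hi
          nlinarith
        · have := h1 i hi
          linarith
    _ = _ := by
        rw [Finset.prod_mul_distrib, aux_prod_weight S univ (Finset.subset_univ _), hS,
          Finset.prod_const, Finset.card_univ]

open NumberField NumberField.InfinitePlace in
theorem aux_approx_s16 (K : Type*) [Field K] [NumberField K] :
    ∃ R : ℝ, 0 ≤ R ∧ ∀ n : InfinitePlace K → ℝ, (∀ v, 0 ≤ n v) →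
      ∃ (α : 𝓞 K) (u : (K →+* ℂ) → ℂ),
        (∀ φ : K →+* ℂ, ‖φ (α : K) - u φ‖ ≤ R) ∧ (∀ φ, ‖u φ‖ = n (InfinitePlace.mk φ)) ∧
        (∀ φ ψ : K →+* ℂ, φ ≠ ψ → InfinitePlace.mk φ = InfinitePlace.mk ψ → u ψ = - u φ) := by
  classical
  let b := mixedEmbedding.latticeBasis K
  refine ⟨∑ i, ‖b i‖, Finset.sum_nonneg fun _ _ => norm_nonneg _, fun n hn => ?_⟩
  let p : mixedEmbedding.mixedSpace K := (fun v => n v.1, fun v => n v.1 * Complex.I)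
  have hfl := (ZSpan.floor b p).2
  rw [mixedEmbedding.mem_span_latticeBasis] at hfl
  obtain ⟨α, hα⟩ := hfl
  have hα' : mixedEmbedding K (α : K) = (ZSpan.floor b p : mixedEmbedding.mixedSpace K) := hα
  have hb : ‖mixedEmbedding K (α : K) - p‖ ≤ ∑ i, ‖b i‖ := by
    rw [hα', norm_sub_rev]
    exact ZSpan.norm_fract_le b p
  have hre : ∀ v : {w : InfinitePlace K // IsReal w},
      ‖v.1.embedding (α : K) - (n v.1 : ℂ)‖ ≤ ∑ i, ‖b i‖ := by
    intro v
    refine le_trans ?_ ((norm_le_pi_norm _ v).trans ((norm_fst_le _).trans hb))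
    rw [Prod.fst_sub, Pi.sub_apply, mixedEmbedding.mixedEmbedding_apply_isReal,
      ← embedding_of_isReal_apply v.2, ← Complex.ofReal_sub, Complex.norm_real]
  have hco : ∀ v : {w : InfinitePlace K // IsComplex w},
      ‖v.1.embedding (α : K) - (n v.1 : ℂ) * Complex.I‖ ≤ ∑ i, ‖b i‖ := by
    intro v
    refine le_trans ?_ ((norm_le_pi_norm _ v).trans ((norm_snd_le _).trans hb))
    rw [Prod.snd_sub, Pi.sub_apply, mixedEmbedding.mixedEmbedding_apply_isComplex]
  let u : (K →+* ℂ) → ℂ := fun φ =>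
    if ComplexEmbedding.IsReal φ then (n (InfinitePlace.mk φ) : ℂ)
    else if φ = (InfinitePlace.mk φ).embedding then (n (InfinitePlace.mk φ) : ℂ) * Complex.I else -((n (InfinitePlace.mk φ) : ℂ) * Complex.I)
  refine ⟨α, u, fun φ => ?_, fun φ => ?_, fun φ ψ hne hmk => ?_⟩
  · by_cases hr : ComplexEmbedding.IsReal φ
    · have := hre ⟨InfinitePlace.mk φ, isReal_mk_iff.mpr hr⟩
      rw [embedding_mk_eq_of_isReal hr] at this
      simpa [u, hr] using this
    · have h := hco ⟨InfinitePlace.mk φ, isComplex_mk_iff.mpr hr⟩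
      by_cases he : φ = (InfinitePlace.mk φ).embedding
      · simp only [u, if_neg hr, if_pos he]
        simp only [← he] at h
        exact h
      · simp only [u, if_neg hr, if_neg he]
        have he' : (InfinitePlace.mk φ).embedding = ComplexEmbedding.conjugate φ :=
          (embedding_mk_eq φ).resolve_left fun h => he h.symm
        simp only [he', ComplexEmbedding.conjugate_coe_eq] at h
        rw [← Complex.norm_conj] at h
        simpa using h
  · simp only [u]
    split_ifs <;> simp [abs_of_nonneg (hn _)]
  · have hc : ComplexEmbedding.conjugate φ = ψ := (mk_eq_iff.mp hmk).resolve_left hne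
    have hr : ¬ ComplexEmbedding.IsReal φ := fun h => hne (by
      rw [← hc, ComplexEmbedding.isReal_iff.mp h])
    have hr' : ¬ ComplexEmbedding.IsReal ψ := by
      rw [← hc, ComplexEmbedding.isReal_conjugate_iff]; exact hr
    simp only [u, if_neg hr, if_neg hr', ← hmk]
    rcases embedding_mk_eq φ with h | h
    · rw [h, if_pos rfl, if_neg hne.symm]
    · rw [h, hc, if_pos rfl, if_neg hne, neg_neg]

open NumberField NumberField.InfinitePlace in
theorem aux_family (K : Type*) [Field K] [NumberField K] (σ : K →+* ℂ) :
    ∃ D : ℝ, 1 ≤ D ∧ ∃ N : ℕ, ∀ T : ℕ, N ≤ T → 1 ≤ T → ∃ α : 𝓞 K,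
      (∀ φ ψ : K →+* ℂ, φ ≠ ψ → 1 ≤ ‖φ (α : K) - ψ (α : K)‖) ∧
      (∀ φ ψ : K →+* ℂ, φ ≠ ψ → InfinitePlace.mk φ = InfinitePlace.mk σ → (T : ℝ) ≤ ‖φ (α : K) - ψ (α : K)‖) ∧
      (∀ φ : K →+* ℂ, InfinitePlace.mk φ ≠ InfinitePlace.mk σ → ‖φ (α : K)‖ ≤ D) ∧
      (∀ φ : K →+* ℂ, InfinitePlace.mk φ = InfinitePlace.mk σ → ‖φ (α : K)‖ ≤ D * T) := by
  classical
  obtain ⟨R, hR, hap⟩ := aux_approx_s16 K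
  let e := Fintype.equivFin (InfinitePlace K)
  set B := Fintype.card (InfinitePlace K) with hB
  let A : ℝ := 2 * R + 1
  have hA : 1 ≤ A := by simp only [A]; linarith
  refine ⟨A * (B + 2) + R, by nlinarith [(Nat.cast_nonneg B : (0 : ℝ) ≤ B)], B, fun T hT hT1 => ?_⟩
  let k : InfinitePlace K → ℕ := fun v => if v = InfinitePlace.mk σ then 2 * T else (e v : ℕ) + 1
  have hk1 : ∀ v, 1 ≤ k v := by intro v; simp only [k]; split_ifs <;> omega
  have hkB : ∀ v, v ≠ InfinitePlace.mk σ → k v ≤ B := by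
    intro v hv; simp only [k, if_neg hv]; exact (e v).2
  have hkσ : k (InfinitePlace.mk σ) = 2 * T := by simp [k]
  have hkne : ∀ v w, v ≠ w → k v ≠ k w := by
    intro v w hvw h
    by_cases hv : v = InfinitePlace.mk σ
    · have := hkB w (by rw [← hv]; exact hvw.symm)
      rw [hv, hkσ] at h; omega
    · by_cases hw : w = InfinitePlace.mk σ
      · have := hkB v hv
        rw [hw, hkσ] at h; omega
      · simp only [k, if_neg hv, if_neg hw] at h
        exact hvw (e.injective (Fin.ext (by omega)))
  obtain ⟨α, u, h1, h2, h3⟩ := hap (fun v => A * k v) (fun v => by positivity)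
  have hT1' : (1 : ℝ) ≤ T := by exact_mod_cast hT1
  -- a lower bound for differences
  have hdiff : ∀ φ ψ : K →+* ℂ, ∀ δ : ℝ, 1 ≤ δ → A * δ ≤ ‖u φ - u ψ‖ →
      δ ≤ ‖φ (α : K) - ψ (α : K)‖ := by
    intro φ ψ δ hδ h
    have hA1 : u φ - u ψ = (φ (α : K) - ψ (α : K)) - (φ (α : K) - u φ) + (ψ (α : K) - u ψ) := by
      ring
    have : ‖u φ - u ψ‖ ≤ ‖φ (α : K) - ψ (α : K)‖ + R + R := by
      rw [hA1]
      refine (norm_add_le _ _).trans (add_le_add ((norm_sub_le _ _).trans ?_) (h1 ψ))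
      exact add_le_add le_rfl (h1 φ)
    simp only [A] at h
    nlinarith
  have hu : ∀ φ ψ : K →+* ℂ, InfinitePlace.mk φ ≠ InfinitePlace.mk ψ → A * |(k (InfinitePlace.mk φ) : ℝ) - k (InfinitePlace.mk ψ)| ≤ ‖u φ - u ψ‖ := by
    intro φ ψ _
    have := abs_norm_sub_norm_le (u φ) (u ψ)
    rw [h2, h2, ← mul_sub, abs_mul, abs_of_nonneg (by linarith : 0 ≤ A)] at this
    exact this
  have hu' : ∀ φ ψ : K →+* ℂ, φ ≠ ψ → InfinitePlace.mk φ = InfinitePlace.mk ψ → A * k (InfinitePlace.mk φ) ≤ ‖u φ - u ψ‖ := by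
    intro φ ψ hne hmk
    rw [h3 φ ψ hne hmk, sub_neg_eq_add, ← two_mul, norm_mul, h2]
    have : 0 ≤ A * k (InfinitePlace.mk φ) := by positivity
    simp only [Complex.norm_ofNat]
    linarith
  refine ⟨α, fun φ ψ hne => ?_, fun φ ψ hne hφ => ?_, fun φ hφ => ?_, fun φ hφ => ?_⟩
  · apply hdiff φ ψ 1 le_rfl
    by_cases hmk : InfinitePlace.mk φ = InfinitePlace.mk ψ
    · refine le_trans ?_ (hu' φ ψ hne hmk)
      have : (1 : ℝ) ≤ k (InfinitePlace.mk φ) := by exact_mod_cast hk1 _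
      exact mul_le_mul_of_nonneg_left this (by linarith)
    · refine le_trans ?_ (hu φ ψ hmk)
      refine mul_le_mul_of_nonneg_left ?_ (by linarith)
      have h := hkne _ _ hmk
      have h' : (k (InfinitePlace.mk φ) : ℤ) - k (InfinitePlace.mk ψ) ≠ 0 := by omega
      exact_mod_cast Int.one_le_abs h'
  · apply hdiff φ ψ T hT1'
    by_cases hmk : InfinitePlace.mk φ = InfinitePlace.mk ψ
    · refine le_trans ?_ (hu' φ ψ hne hmk)
      refine mul_le_mul_of_nonneg_left ?_ (by linarith)
      rw [hφ, hkσ]; push_cast; linarith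
    · refine le_trans ?_ (hu φ ψ hmk)
      refine mul_le_mul_of_nonneg_left (le_trans ?_ (le_abs_self _)) (by linarith)
      have h := hkB (InfinitePlace.mk ψ) (by rw [← hφ]; exact fun h => hmk h.symm)
      have h' : (k (InfinitePlace.mk ψ) : ℝ) ≤ T := by exact_mod_cast h.trans hT
      rw [hφ, hkσ]; push_cast; linarith
  · have h : ‖φ (α : K)‖ ≤ R + A * k (InfinitePlace.mk φ) := by
      rw [← h2 φ]
      calc ‖φ (α : K)‖ = ‖(φ (α : K) - u φ) + u φ‖ := by ring_nf
        _ ≤ _ := (norm_add_le _ _).trans (add_le_add (h1 φ) le_rfl)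
    have h' : (k (InfinitePlace.mk φ) : ℝ) ≤ B := by exact_mod_cast hkB _ hφ
    nlinarith
  · have h : ‖φ (α : K)‖ ≤ R + A * k (InfinitePlace.mk φ) := by
      rw [← h2 φ]
      calc ‖φ (α : K)‖ = ‖(φ (α : K) - u φ) + u φ‖ := by ring_nf
        _ ≤ _ := (norm_add_le _ _).trans (add_le_add (h1 φ) le_rfl)
    rw [hφ, hkσ] at h
    push_cast at h
    have hBB : (0 : ℝ) ≤ A * B * T := by positivity
    nlinarith [mul_le_mul_of_nonneg_left hT1' hR]

/-- Embeddings separate `α`, so `α` generates. -/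
theorem aux_gen (K : Type*) [Field K] [NumberField K] (x : K)
    (h : Function.Injective fun φ : K →+* ℂ => φ x) : Algebra.adjoin ℚ {x} = ⊤ := by
  have h1 : IntermediateField.adjoin ℚ {x} = ⊤ := by
    rw [Field.primitive_element_iff_algHom_eq_of_eval' ℚ ℂ (fun _ => IsAlgClosed.splits _)]
    intro φ ψ hφ
    have : (φ : K →+* ℂ) = ψ := h hφ
    exact AlgHom.coe_ringHom_injective this
  rw [← IntermediateField.adjoin_simple_toSubalgebra_of_isAlgebraic
    (Algebra.IsAlgebraic.isAlgebraic x), h1, IntermediateField.top_toSubalgebra]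

/-- Let `K` be a number field of degree `d` with at least one non-real embedding.
There exists `c_K > 0` depending only on `K` such that there are infinitely many
`α ∈ O_K` with `K = ℚ(α)` and `‖f_{α,ℤ}‖₁^(2d-3) ≤ c_K |Δ(f_{α,ℤ})|`, where `‖f‖₁`
is the sum of the absolute values of the coefficients of `f`. -/
theorem small_L1_generators_complex (K : Type*) [Field K] [NumberField K]
    (d : ℕ) (hd : d = Module.finrank ℚ K)
    (hcx : ∃ σ : K →+* ℂ, ¬ NumberField.ComplexEmbedding.IsReal σ) :
    ∃ cK : ℝ, 0 < cK ∧
      {α : NumberField.RingOfIntegers K |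
        Algebra.adjoin ℚ {(α : K)} = ⊤ ∧
        ∀ β : Fin d → ℂ,
          (minpoly ℤ α).map (algebraMap ℤ ℂ) = ∏ i, (X - C (β i)) →
            (∑ i ∈ Finset.range (d + 1), |((minpoly ℤ α).coeff i : ℝ)|) ^ (2 * d - 3) ≤
              cK * ‖∏ i, ∏ j ∈ univ.filter (fun j => i < j), (β i - β j) ^ 2‖}.Infinite := by
  classical
  obtain ⟨σ, hσ⟩ := hcx
  obtain ⟨D, hD, N, hfam⟩ := aux_family K σ
  have hcard : Fintype.card (K →+* ℂ) = d := by
    rw [hd]; exact NumberField.Embeddings.card K ℂ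
  let S : Finset (K →+* ℂ) := univ.filter fun φ =>
    NumberField.InfinitePlace.mk φ = NumberField.InfinitePlace.mk σ
  have hS : S.card = 2 := by
    have := NumberField.InfinitePlace.card_filter_mk_eq (NumberField.InfinitePlace.mk σ)
    rw [NumberField.InfinitePlace.IsComplex.mult_eq_two
      (NumberField.InfinitePlace.isComplex_mk_iff.mpr hσ)] at this
    convert this
  have hmS : ∀ φ, φ ∈ S ↔ NumberField.InfinitePlace.mk φ = NumberField.InfinitePlace.mk σ := by
    intro φ; simp [S]
  refine ⟨((2 * D) ^ d) ^ (2 * d - 3), by positivity, fun hfin => ?_⟩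
  -- the norms at `σ` would be bounded
  obtain ⟨M, hM⟩ := (hfin.image fun α : NumberField.RingOfIntegers K => ‖σ (α : K)‖).bddAbove
  obtain ⟨T, hTM⟩ := exists_nat_gt (2 * M)
  let T' := max (max N 1) T
  have hT'1 : 1 ≤ T' := by simp [T']
  obtain ⟨α, h1, h2, h3, h4⟩ := hfam T' (by simp [T']) hT'1
  have hT'1' : (1 : ℝ) ≤ T' := by exact_mod_cast hT'1
  have hinj : Function.Injective fun φ : K →+* ℂ => φ (α : K) := by
    intro φ ψ h
    by_contra hne
    have := h1 φ ψ hne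
    simp only at h
    rw [h, sub_self, norm_zero] at this
    linarith
  have hmem : ‖σ (α : K)‖ ≤ M := by
    refine hM ⟨α, ⟨aux_gen K _ hinj, fun β hβ => ?_⟩, rfl⟩
    -- match roots with embeddings
    have hroot : ∀ φ : K →+* ℂ, ∃ i, β i = φ (α : K) := by
      intro φ
      have h0 : ((minpoly ℤ α).map (algebraMap ℤ ℂ)).eval (φ (α : K)) = 0 := by
        have := congrArg (φ.comp (algebraMap (NumberField.RingOfIntegers K) K))
          (minpoly.aeval ℤ α)
        rw [map_zero, aeval_def, hom_eval₂] at this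
        have hrh : ((φ.comp (algebraMap (NumberField.RingOfIntegers K) K)).comp
            (algebraMap ℤ (NumberField.RingOfIntegers K))) = algebraMap ℤ ℂ :=
          RingHom.ext_int _ _
        rw [hrh] at this
        rw [eval_map]
        exact this
      rw [hβ, eval_prod, Finset.prod_eq_zero_iff] at h0
      obtain ⟨i, _, hi⟩ := h0
      refine ⟨i, ?_⟩
      simp only [eval_sub, eval_X, eval_C] at hi
      exact (sub_eq_zero.mp hi).symm
    choose g hg using hroot
    have ginj : Function.Injective g := fun φ ψ h => hinj (by
      simp only; rw [← hg φ, ← hg ψ, h])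
    have gbij : Function.Bijective g :=
      (Fintype.bijective_iff_injective_and_card g).mpr ⟨ginj, by rw [hcard, Fintype.card_fin]⟩
    let e := Equiv.ofBijective g gbij
    have he : ∀ φ, β (e φ) = φ (α : K) := hg
    -- upper bound
    have hup : ∑ i ∈ Finset.range (d + 1), |((minpoly ℤ α).coeff i : ℝ)|
        ≤ (2 * D) ^ d * (T' : ℝ) ^ 2 := by
      have hc : ∀ i, |((minpoly ℤ α).coeff i : ℝ)| = ‖(∏ i, (X - C (β i))).coeff i‖ := by
        intro i
        rw [← hβ, coeff_map]
        simp
      simp only [hc]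
      refine (aux_L1_le univ β (d + 1)).trans ?_
      rw [← e.prod_comp]
      simp only [he]
      rw [← hcard]
      exact aux_upper (fun φ : K →+* ℂ => φ (α : K)) S hS T' D hT'1' hD
        (fun φ hφ => h3 φ (by rwa [hmS] at hφ)) (fun φ hφ => h4 φ ((hmS φ).mp hφ))
    -- lower bound
    have hlow : ((T' : ℝ) ^ 2) ^ (2 * d - 3)
        ≤ ‖∏ i, ∏ j ∈ univ.filter (fun j => i < j), (β i - β j) ^ 2‖ := by
      have hconv : ‖∏ i, ∏ j ∈ univ.filter (fun j => i < j), (β i - β j) ^ 2‖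
          = ∏ φ : K →+* ℂ, ∏ ψ ∈ {φ}ᶜ, ‖ψ (α : K) - φ (α : K)‖ := by
        have hI : ‖∏ i, ∏ j ∈ univ.filter (fun j => i < j), (β i - β j) ^ 2‖
            = ∏ i, ∏ j ∈ Finset.Ioi i, (‖β j - β i‖ * ‖β i - β j‖) := by
          rw [norm_prod]
          refine Finset.prod_congr rfl fun i _ => ?_
          rw [norm_prod]
          refine Finset.prod_congr (by ext; simp) fun j _ => ?_
          rw [norm_pow, norm_sub_rev (β j), sq]
        rw [hI, Finset.prod_prod_Ioi_mul_eq_prod_prod_off_diag (fun i j => ‖β i - β j‖),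
          ← e.prod_comp]
        refine Finset.prod_congr rfl fun φ _ => ?_
        symm
        refine Finset.prod_bij (fun ψ _ => e ψ) ?_ ?_ ?_ ?_
        · intro ψ hψ; simpa using hψ
        · intro a _ b _ h; exact e.injective h
        · intro j hj
          refine ⟨e.symm j, ?_, by simp⟩
          simp only [mem_compl, mem_singleton] at hj ⊢
          rintro rfl
          simp at hj
        · intro ψ _
          rw [he, he]
      rw [hconv, ← hcard]
      exact aux_disc_lower (fun φ : K →+* ℂ => φ (α : K)) S hS T' hT'1' h1
        (fun φ ψ hne hφ => h2 φ ψ hne ((hmS φ).mp hφ))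
    calc _ ≤ ((2 * D) ^ d * (T' : ℝ) ^ 2) ^ (2 * d - 3) :=
          pow_le_pow_left₀ (Finset.sum_nonneg fun _ _ => abs_nonneg _) hup _
      _ = ((2 * D) ^ d) ^ (2 * d - 3) * ((T' : ℝ) ^ 2) ^ (2 * d - 3) := mul_pow _ _ _
      _ ≤ _ := mul_le_mul_of_nonneg_left hlow (by positivity)
  -- contradiction
  have hne : σ ≠ NumberField.ComplexEmbedding.conjugate σ := fun h =>
    hσ (NumberField.ComplexEmbedding.isReal_iff.mpr h.symm)
  have h5 := h2 σ _ hne rfl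
  have h6 := norm_sub_le (σ (α : K)) (NumberField.ComplexEmbedding.conjugate σ (α : K))
  rw [NumberField.ComplexEmbedding.conjugate_coe_eq, Complex.norm_conj] at h6
  rw [NumberField.ComplexEmbedding.conjugate_coe_eq] at h5
  have h7 : (T : ℝ) ≤ T' := by exact_mod_cast le_max_right _ _
  linarith
end
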